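/- arXiv:2006.06333 — 5 statements merged into one kernel-verified Lean document; each statement's English description precedes it below -/
import Mathlib

section
/- Let x ∈ W. If there exists a vertex x_i ∈ E(P) with x_i→x, then E(P) ↦ x; if there exists a vertex x_i ∈ O(P) with x_i→x, then O(P) ↦ x. -/
variable {V : Type*}

/-- Two vertices are adjacent in the digraph with arc relation `A`. -/
def DAdj (A : V → V → Prop) (x y : V) : Prop := A x y ∨ A y x

/-- `x 0, x 1, …, x n` is a directed path of length `n` (distinct vertices, consecutive arcs). -/
def IsDipathOn (A : V → V → Prop) (n : ℕ) (x : ℕ → V) : Prop :=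
  (∀ i j, i ≤ n → j ≤ n → x i = x j → i = j) ∧ ∀ i, i < n → A (x i) (x (i + 1))

/-- There is a directed path of length `n` from `u` to `v`. -/
def HasDipath (A : V → V → Prop) (n : ℕ) (u v : V) : Prop :=
  ∃ x : ℕ → V, IsDipathOn A n x ∧ x 0 = u ∧ x n = v

/-- A digraph is `k`-quasi-transitive if the endpoints of every path of length `k` are adjacent. -/
def KQuasiTransitive (A : V → V → Prop) (k : ℕ) : Prop :=
  ∀ x : ℕ → V, IsDipathOn A k x → DAdj A (x 0) (x k)

/-- A digraph is strong if every vertex is reachable from every other vertex. -/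
def StrongD (A : V → V → Prop) : Prop := ∀ u v : V, ∃ n, HasDipath A n u v

/-- The subdigraph induced on `S` is semicomplete. -/
def SemicompleteOn (A : V → V → Prop) (S : Set V) : Prop :=
  ∀ x ∈ S, ∀ y ∈ S, x ≠ y → DAdj A x y

/-- The subdigraph induced on `S` is semicomplete bipartite. -/
def SemicompleteBipartiteOn (A : V → V → Prop) (S : Set V) : Prop :=
  ∃ X Y : Set V, X ∪ Y = S ∧ X ∩ Y = ∅ ∧
    (∀ x ∈ X, ∀ y ∈ X, ¬ DAdj A x y) ∧
    (∀ x ∈ Y, ∀ y ∈ Y, ¬ DAdj A x y) ∧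
    (∀ x ∈ X, ∀ y ∈ Y, DAdj A x y)

/-- The subdigraph induced on `S` has no arcs. -/
def EmptyOn (A : V → V → Prop) (S : Set V) : Prop :=
  ∀ x ∈ S, ∀ y ∈ S, ¬ A x y

/-- The vertex set `{P 0, …, P n}` of a path. -/
def VertsUpTo (n : ℕ) (P : ℕ → V) : Set V := {w | ∃ i ≤ n, P i = w}

/-- The odd-indexed vertices among `{P 0, …, P n}`. -/
def OddVertsUpTo (n : ℕ) (P : ℕ → V) : Set V := {w | ∃ i, i ≤ n ∧ Odd i ∧ P i = w}

/-- The even-indexed vertices among `{P 0, …, P n}`. -/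
def EvenVertsUpTo (n : ℕ) (P : ℕ → V) : Set V := {w | ∃ i, i ≤ n ∧ Even i ∧ P i = w}

/-- `I`: vertices outside `S` receiving no arc from `S`. -/
def ISet (A : V → V → Prop) (S : Set V) : Set V :=
  {x | x ∉ S ∧ ∀ w ∈ S, ¬ A w x}

/-- `W`: vertices outside `S` sending no arc to `S`. -/
def WSet (A : V → V → Prop) (S : Set V) : Set V :=
  {x | x ∉ S ∧ ∀ w ∈ S, ¬ A x w}

/-- `B`: vertices outside `S` that are in neither `I` nor `W`. -/
def BSet (A : V → V → Prop) (S : Set V) : Set V :=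
  {x | x ∉ S ∧ x ∉ ISet A S ∧ x ∉ WSet A S}

/-- In a `(k + 1)`-quasi-transitive digraph, a path of length `k` from `y 0` whose last vertex
dominates a new vertex `x` forces `y 0` to dominate `x`, unless `x` dominates `y 0`. -/
theorem KQuasiTransitive.arc_of_dipath {V : Type*} {A : V → V → Prop} {k : ℕ}
    (hQT : KQuasiTransitive A (k + 1)) {y : ℕ → V} (hy : IsDipathOn A k y) {x : V}
    (hne : ∀ i ≤ k, y i ≠ x) (hlast : A (y k) x) (hno : ¬ A x (y 0)) : A (y 0) x := by
  have h := hQT (fun t => if t ≤ k then y t else x) ⟨?_, ?_⟩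
  · simpa [DAdj, hno] using h
  · intro i j hi hj hij
    have hinj := hy.1 i j
    have hi' := hne i
    have hj' := hne j
    grind
  · intro i hi
    rcases Nat.lt_or_ge i k with h | h
    · have := hy.2 i h
      grind
    · obtain rfl : i = k := by omega
      simpa using hlast

/-- Three arcs through vertices of a path in increasing order, from its first vertex to its last,
form a path of length three. -/
theorem hasDipath_three {V : Type*} {A : V → V → Prop} {n : ℕ} {P : ℕ → V}
    (hP : IsDipathOn A n P) {p q : ℕ} (h0 : 0 < p) (hpq : p < q) (hqn : q < n)
    (h1 : A (P 0) (P p)) (h2 : A (P p) (P q)) (h3 : A (P q) (P n)) :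
    HasDipath A 3 (P 0) (P n) := by
  let g : ℕ → ℕ := fun t => if t = 0 then 0 else if t = 1 then p else if t = 2 then q else n
  refine ⟨fun t => P (g t), ⟨?_, ?_⟩, rfl, rfl⟩
  · intro i j hi hj hij
    have := hP.1 (g i) (g j) (by grind) (by grind) hij
    grind
  · intro i hi
    interval_cases i <;> simpa [g]

/-- An arc `P (a + k + 1) → P a` closes a segment of a path into a cycle of length `k + 2`, and
following this cycle from `P (i + 2)` to `P i` is a path of length `k`. -/
theorem isDipathOn_wrap {V : Type*} {A : V → V → Prop} {k a i : ℕ} {P : ℕ → V}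
    (hP : IsDipathOn A (k + 3) P) (ha : a ≤ 2) (hi : i + 2 ≤ a + k + 1)
    (hback : A (P (a + k + 1)) (P a)) :
    IsDipathOn A k
      (fun t => P (if i + 2 + t ≤ a + k + 1 then i + 2 + t else t + i - k)) := by
  refine ⟨?_, ?_⟩
  · intro s t hs ht hst
    have := hP.1 _ _ (by split_ifs <;> omega) (by split_ifs <;> omega) hst
    split_ifs at this <;> omega
  · intro t ht
    rcases lt_trichotomy (i + 2 + t) (a + k + 1) with h | h | h
    · simp only [h.le, if_true, show i + 2 + (t + 1) ≤ a + k + 1 by omega]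
      exact hP.2 (i + 2 + t) (by omega)
    · simp only [h, le_refl, if_true, show ¬ i + 2 + (t + 1) ≤ a + k + 1 by omega, if_false]
      rwa [show t + 1 + i - k = a by omega]
    · have := hP.2 (t + i - k) (by omega)
      simp only [show ¬ i + 2 + t ≤ a + k + 1 by omega,
        show ¬ i + 2 + (t + 1) ≤ a + k + 1 by omega, if_false]
      rwa [show t + 1 + i - k = t + i - k + 1 by omega]

/-- A vertex outside a shortest path of length `k + 2` (written with `k + 1` for `k`) which sends
no arc to the path and is dominated by one vertex of it is dominated by all vertices of the same
parity. -/
theorem arc_of_arc_of_parity {V : Type*} {A : V → V → Prop} {k : ℕ} (hk : 4 ≤ k)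
    (hkeven : Even k) (hQT : KQuasiTransitive A (k + 1)) {P : ℕ → V}
    (hP : IsDipathOn A (k + 3) P) (hdist : ¬ HasDipath A 3 (P 0) (P (k + 3)))
    {x : V} (hx : x ∈ WSet A (VertsUpTo (k + 3) P)) {i j : ℕ} (hi : i ≤ k + 3) (hj : j ≤ k + 3)
    (hij : i % 2 = j % 2) (h : A (P i) x) : A (P j) x := by
  have hne : ∀ i ≤ k + 3, P i ≠ x := fun i hi h => hx.1 ⟨i, hi, h⟩
  have hno : ∀ i ≤ k + 3, ¬ A x (P i) := fun i hi => hx.2 _ ⟨i, hi, rfl⟩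
  have hsub : ∀ a m, a + m ≤ k + 3 → IsDipathOn A m (fun t => P (a + t)) := by
    refine fun a m ham => ⟨fun s t hs ht hst => ?_, fun t ht => hP.2 (a + t) (by omega)⟩
    have := hP.1 _ _ (by omega) (by omega) hst
    omega
  have hback0 : A (P (k + 1)) (P 0) := by
    have := hQT _ (hsub 0 (k + 1) (by omega))
    simp only [DAdj, Nat.zero_add] at this
    refine this.resolve_left fun hc => hdist ?_
    exact hasDipath_three hP (p := k + 1) (q := k + 2) (by omega) (by omega) (by omega) hc
      (hP.2 _ (by omega)) (hP.2 _ (by omega))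
  have hback2 : A (P (2 + k + 1)) (P 2) := by
    have := hQT _ (hsub 2 (k + 1) (by omega))
    simp only [DAdj, Nat.add_zero, ← Nat.add_assoc] at this
    refine this.resolve_left fun hc => hdist ?_
    refine hasDipath_three hP (p := 1) (q := 2) (by omega) (by omega) (by omega)
      (hP.2 _ (by omega)) (hP.2 _ (by omega)) ?_
    rwa [show k + 3 = 2 + k + 1 by omega]
  have hdown : ∀ m, m ≤ 3 → A (P (m + k)) x → A (P m) x := by
    intro m hm h
    exact hQT.arc_of_dipath (hsub m k (by omega)) (fun t ht => hne _ (by omega)) h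
      (hno _ (by omega))
  have hstep : ∀ m, m + 2 ≤ k + 3 → A (P m) x → A (P (m + 2)) x := by
    intro m hm h
    have key : ∀ a, a ≤ 2 → a ≤ m → m + 2 ≤ a + k + 1 → A (P (a + k + 1)) (P a) →
        A (P (m + 2)) x := by
      intro a ha ham hma hback
      have := hQT.arc_of_dipath (isDipathOn_wrap hP ha hma hback) (x := x)
        (fun t ht => hne _ (by split_ifs <;> omega))
        (by simpa [show ¬ m + 2 + k ≤ a + k + 1 by omega] using h)
        (hno _ (by split_ifs <;> omega))
      simpa [hma] using this
    rcases Nat.lt_or_ge (k + 1) (m + 2) with hm' | hm'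
    · exact key 2 le_rfl (by omega) (by omega) hback2
    · exact key 0 (by omega) (by omega) (by omega) (by simpa using hback0)
  have hup : ∀ n m, m + 2 * n ≤ k + 3 → A (P m) x → A (P (m + 2 * n)) x := by
    intro n
    induction n with
    | zero => exact fun m _ h => h
    | succ n ih =>
      exact fun m hm h => hstep _ (by omega) (ih m (by omega) h)
  have hup' : ∀ m n, m ≤ n → m % 2 = n % 2 → n ≤ k + 3 → A (P m) x → A (P n) x := by
    intro m n hmn hpar hn h
    have := hup ((n - m) / 2) m (by omega) h
    rwa [show m + 2 * ((n - m) / 2) = n by omega] at this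
  have hk2 : k % 2 = 0 := Nat.even_iff.mp hkeven
  have hmid : A (P (j % 2 + 2)) x := by
    refine hdown _ (by omega) (hup' i _ (by omega) (by omega) (by omega) h)
  have hlow : A (P (j % 2)) x :=
    hdown _ (by omega) (hup' (j % 2 + 2) _ (by omega) (by omega) (by omega) hmid)
  exact hup' (j % 2) j (by omega) (by omega) hj hlow

theorem stmt_9
    {V : Type*} [Fintype V] (A : V → V → Prop) (hirr : Irreflexive A)
    (k : ℕ) (hk5 : 5 ≤ k) (hkodd : Odd k)
    (hQT : KQuasiTransitive A k) (hstrong : StrongD A)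
    (u v : V) (hdist : ∀ m, m < k + 2 → ¬ HasDipath A m u v)
    (P : ℕ → V) (hP : IsDipathOn A (k + 2) P) (hPu : P 0 = u) (hPv : P (k + 2) = v) :
    ∀ x ∈ WSet A (VertsUpTo (k + 2) P),
      ((∃ i, i ≤ k + 2 ∧ Even i ∧ A (P i) x) →
        (∀ w ∈ EvenVertsUpTo (k + 2) P, A w x) ∧
        (∀ w ∈ EvenVertsUpTo (k + 2) P, ¬ A x w)) ∧
      ((∃ i, i ≤ k + 2 ∧ Odd i ∧ A (P i) x) →
        (∀ w ∈ OddVertsUpTo (k + 2) P, A w x) ∧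
        (∀ w ∈ OddVertsUpTo (k + 2) P, ¬ A x w)) := by
  obtain ⟨k, rfl⟩ : ∃ l, k = l + 1 := ⟨k - 1, by omega⟩
  have hkeven : Even k := by grind
  subst hPu hPv
  intro x hx
  have key : ∀ i j, i ≤ k + 3 → j ≤ k + 3 → i % 2 = j % 2 → A (P i) x → A (P j) x :=
    fun i j hi hj => arc_of_arc_of_parity (by omega) hkeven hQT hP (hdist 3 (by omega)) hx hi hj
  refine ⟨?_, ?_⟩ <;>
  · rintro ⟨i, hi, hpi, h⟩
    refine ⟨?_, ?_⟩ <;> rintro _ ⟨j, hj, hpj, rfl⟩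
    · exact key i j hi hj (by grind) h
    · exact hx.2 _ ⟨j, hj, rfl⟩
end

section
/- Let x ∈ B. If x is adjacent to some vertex of O(P), then either x is adjacent to every vertex of O(P), or there exist odd indices s, t with 3 ≤ t < s ≤ k such that {x_s, x_{s+2}, …, x_{k+2}} ↦ x and x ↦ {x_1, x_3, …, x_t}. If x is adjacent to some vertex of E(P), then either x is adjacent to every vertex of E(P), or there exist even indices s, t with 2 ≤ t < s ≤ k−1 such that {x_s, x_{s+2}, …, x_{k+1}} ↦ x and x ↦ {x_0, x_2, …, x_t}. -/
variable {V : Type*}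

/-- There is a directed path of length `m` from `P i` to `P j` all of whose vertices are of the
form `P t` with `t ∈ S`. -/
def HasDipathWithin (A : V → V → Prop) (P : ℕ → V) (S : Set ℕ) (m i j : ℕ) : Prop :=
  ∃ g : ℕ → ℕ, (∀ t ≤ m, g t ∈ S) ∧ (∀ s t, s ≤ m → t ≤ m → g s = g t → s = t) ∧
    (∀ t < m, A (P (g t)) (P (g (t + 1)))) ∧ g 0 = i ∧ g m = j

section Dipath

variable {A : V → V → Prop} {n : ℕ} {P : ℕ → V}

theorem KQuasiTransitive.dAdj {k : ℕ} {x y : V} (hQT : KQuasiTransitive A k)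
    (h : HasDipath A k x y) : DAdj A x y := by
  obtain ⟨f, hf, rfl, rfl⟩ := h
  exact hQT f hf

theorem DAdj.symm {x y : V} (h : DAdj A x y) : DAdj A y x := Or.symm h

theorem HasDipathWithin.mono {S T : Set ℕ} {m i j : ℕ} (h : HasDipathWithin A P S m i j)
    (hST : S ⊆ T) : HasDipathWithin A P T m i j := by
  obtain ⟨g, hS, h⟩ := h
  exact ⟨g, fun t ht => hST (hS t ht), h⟩

theorem HasDipathWithin.hasDipath (hP : IsDipathOn A n P) {m i j : ℕ}
    (h : HasDipathWithin A P (Set.Iic n) m i j) : HasDipath A m (P i) (P j) := by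
  obtain ⟨g, hS, hinj, harc, rfl, rfl⟩ := h
  exact ⟨fun t => P (g t), ⟨fun s t hs ht hst =>
    hinj s t hs ht (hP.1 _ _ (hS s hs) (hS t ht) hst), harc⟩, rfl, rfl⟩

theorem HasDipathWithin.hasDipath_cons (hP : IsDipathOn A n P) {m i j : ℕ} {x : V}
    (h : HasDipathWithin A P (Set.Iic n) m i j) (hx : ∀ t ≤ n, P t ≠ x) (hxi : A x (P i)) :
    HasDipath A (m + 1) x (P j) := by
  obtain ⟨g, hS, hinj, harc, rfl, rfl⟩ := h
  refine ⟨fun t => if t = 0 then x else P (g (t - 1)), ⟨fun s t hs ht hst => ?_, fun t ht => ?_⟩,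
    by simp, by simp⟩
  · by_cases h1 : s = 0 <;> by_cases h2 : t = 0 <;> simp only [h1, h2, if_true, if_false] at hst
    · omega
    · exact absurd hst.symm (hx _ (hS _ (by omega)))
    · exact absurd hst (hx _ (hS _ (by omega)))
    · have := hinj _ _ (by omega) (by omega) (hP.1 _ _ (hS _ (by omega)) (hS _ (by omega)) hst)
      omega
  · rcases t with _ | t
    · simpa using hxi
    · simpa using harc t (by omega)

theorem HasDipathWithin.hasDipath_concat (hP : IsDipathOn A n P) {m i j : ℕ} {x : V}
    (h : HasDipathWithin A P (Set.Iic n) m i j) (hx : ∀ t ≤ n, P t ≠ x) (hjx : A (P j) x) :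
    HasDipath A (m + 1) (P i) x := by
  obtain ⟨g, hS, hinj, harc, rfl, rfl⟩ := h
  refine ⟨fun t => if t = m + 1 then x else P (g t), ⟨fun s t hs ht hst => ?_, fun t ht => ?_⟩,
    by simp, by simp⟩
  · by_cases h1 : s = m + 1 <;> by_cases h2 : t = m + 1 <;>
      simp only [h1, h2, if_true, if_false] at hst
    · omega
    · exact absurd hst.symm (hx _ (hS _ (by omega)))
    · exact absurd hst (hx _ (hS _ (by omega)))
    · exact hinj _ _ (by omega) (by omega) (hP.1 _ _ (hS _ (by omega)) (hS _ (by omega)) hst)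
  · by_cases h : t = m
    · subst h
      simpa using hjx
    · simpa [h, show t ≠ m + 1 by omega] using harc t (by omega)

theorem IsDipathOn.segment (hP : IsDipathOn A n P) {i j : ℕ} (hij : i ≤ j) (hjn : j ≤ n) :
    HasDipathWithin A P (Set.Icc i j) (j - i) i j :=
  ⟨fun t => i + t, fun t ht => ⟨by grind, by grind⟩, fun s t _ _ h => by grind,
    fun t ht => hP.2 (i + t) (by omega), by grind, by grind⟩

/-- Two disjoint paths joined by an arc. -/
theorem HasDipathWithin.append {S T : Set ℕ} {m l i a b j : ℕ}
    (h : HasDipathWithin A P S m i a) (h₂ : HasDipathWithin A P T l b j)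
    (hab : A (P a) (P b)) (hST : Disjoint S T) :
    HasDipathWithin A P (S ∪ T) (m + 1 + l) i j := by
  obtain ⟨g, hS, hinj, harc, rfl, rfl⟩ := h
  obtain ⟨f, hT, hinj₂, harc₂, rfl, rfl⟩ := h₂
  refine ⟨fun t => if t ≤ m then g t else f (t - m - 1), fun t ht => ?_, fun s t hs ht hst => ?_,
    fun t ht => ?_, by simp, ?_⟩
  · by_cases h : t ≤ m
    · simpa [h] using Or.inl (hS t h)
    · simpa [h] using Or.inr (hT (t - m - 1) (by omega))
  · by_cases h1 : s ≤ m <;> by_cases h2 : t ≤ m <;> simp only [h1, h2, if_true, if_false] at hst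
    · exact hinj s t h1 h2 hst
    · exact (hST.ne_of_mem (hS s h1) (hT _ (by omega)) hst).elim
    · exact (hST.ne_of_mem (hS t h2) (hT _ (by omega)) hst.symm).elim
    · have := hinj₂ _ _ (by omega) (by omega) hst
      omega
  · rcases lt_trichotomy t m with h | rfl | h
    · simpa [h.le, Nat.succ_le_of_lt h] using harc t h
    · simpa using hab
    · have := harc₂ (t - m - 1) (by omega)
      simpa [show ¬ t ≤ m by omega, show ¬ t + 1 ≤ m by omega,
        show t + 1 - m - 1 = t - m - 1 + 1 by omega] using this
  · simp [show ¬ m + 1 + l ≤ m by omega, show m + 1 + l - m - 1 = l by omega]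

/-- The path `P i, …, P a, P b, …, P j`. -/
theorem IsDipathOn.splice (hP : IsDipathOn A n P) {i a b j l : ℕ} (hab : A (P a) (P b))
    (hia : i ≤ a) (han : a ≤ n) (hbj : b ≤ j) (hjn : j ≤ n) (hdisj : j < i ∨ a < b)
    (hl : (a - i) + 1 + (j - b) = l) : HasDipathWithin A P (Set.Iic n) l i j := by
  subst hl
  refine ((hP.segment hia han).append (hP.segment hbj hjn) hab ?_).mono ?_
  · rw [Set.disjoint_left]
    simp only [Set.mem_Icc]
    omega
  · intro t
    simp only [Set.mem_union, Set.mem_Icc, Set.mem_Iic]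
    omega

/-- The path `P i, …, P a, P c, …, P e, P b, …, P j`. -/
theorem IsDipathOn.splice_twice (hP : IsDipathOn A n P) {i a c e b j l : ℕ}
    (hac : A (P a) (P c)) (heb : A (P e) (P b)) (hia : i ≤ a) (han : a ≤ n) (hce : c ≤ e)
    (hei : e < i) (hbj : b ≤ j) (hjc : j < c)
    (hl : (a - i) + 1 + (e - c) + 1 + (j - b) = l) :
    HasDipathWithin A P (Set.Iic n) l i j := by
  subst hl
  refine (((hP.segment hia han).append (hP.segment hce (by omega)) hac ?_).append
    (hP.segment hbj (by omega)) heb ?_).mono ?_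
  · rw [Set.disjoint_left]
    simp only [Set.mem_Icc]
    omega
  · rw [Set.disjoint_left]
    simp only [Set.mem_union, Set.mem_Icc]
    omega
  · intro t
    simp only [Set.mem_union, Set.mem_Icc, Set.mem_Iic]
    omega

end Dipath

/-- In a `k`-quasi-transitive digraph with `k ≥ 5` odd, `P 0, …, P (k + 2)` is a shortest path. -/
structure IsGeodesicQT (A : V → V → Prop) (k : ℕ) (P : ℕ → V) : Prop where
  five_le : 5 ≤ k
  odd : Odd k
  quasiTransitive : KQuasiTransitive A k
  isDipathOn : IsDipathOn A (k + 2) P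
  not_hasDipath : ∀ m < k + 2, ¬ HasDipath A m (P 0) (P (k + 2))

namespace IsGeodesicQT

variable {A : V → V → Prop} {k : ℕ} {P : ℕ → V}

theorem not_arc_of_lt (h : IsGeodesicQT A k P) {i j : ℕ} (hij : i + 1 < j) (hj : j ≤ k + 2) :
    ¬ A (P i) (P j) := fun hA =>
  h.not_hasDipath (i + 1 + (k + 2 - j)) (by omega) (HasDipathWithin.hasDipath h.isDipathOn
    (h.isDipathOn.splice hA (Nat.zero_le i) (by omega) hj le_rfl (Or.inr (by omega)) (by omega)))

theorem arc_of_dipath (h : IsGeodesicQT A k P) {i j : ℕ} (hji : j + 1 < i) (hi : i ≤ k + 2)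
    (hp : HasDipathWithin A P (Set.Iic (k + 2)) k i j) : A (P i) (P j) :=
  (h.quasiTransitive.dAdj (hp.hasDipath h.isDipathOn)).resolve_right (h.not_arc_of_lt hji hi)

theorem segment (h : IsGeodesicQT A k P) {i j l : ℕ} (hij : i + l = j) (hj : j ≤ k + 2) :
    HasDipathWithin A P (Set.Iic (k + 2)) l i j := by
  have := (h.isDipathOn.segment (i := i) (j := j) (by omega) hj).mono
    (T := Set.Iic (k + 2)) (fun t ht => ht.2.trans hj)
  rwa [show j - i = l by omega] at this

theorem arc_add_k (h : IsGeodesicQT A k P) {j : ℕ} (hj : j ≤ 2) : A (P (j + k)) (P j) := by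
  have h5 := h.five_le
  exact (h.quasiTransitive.dAdj ((h.segment rfl (by omega)).hasDipath h.isDipathOn)).resolve_left
    (h.not_arc_of_lt (by omega) (by omega))

theorem arc_k_zero (h : IsGeodesicQT A k P) : A (P k) (P 0) := by
  simpa using h.arc_add_k (Nat.zero_le 2)

theorem arc_last_two (h : IsGeodesicQT A k P) : A (P (k + 2)) (P 2) := by
  simpa [add_comm] using h.arc_add_k le_rfl

theorem arc_last_zero (h : IsGeodesicQT A k P) : A (P (k + 2)) (P 0) := by
  have h5 := h.five_le
  exact h.arc_of_dipath (by omega) le_rfl (h.isDipathOn.splice_twice h.arc_last_two h.arc_k_zero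
    le_rfl le_rfl (by omega) (by omega) le_rfl (by omega) (by omega))

theorem arc_last (h : IsGeodesicQT A k P) (r : ℕ) :
    ∀ c, c + 2 * r + 1 = k → A (P (k + 2)) (P c) := by
  have h5 := h.five_le
  induction r with
  | zero =>
    intro c hc
    exact h.arc_of_dipath (by omega) le_rfl (h.isDipathOn.splice h.arc_last_zero
      le_rfl le_rfl (Nat.zero_le c) (by omega) (Or.inl (by omega)) (by omega))
  | succ r ih =>
    intro c hc
    exact h.arc_of_dipath (by omega) le_rfl (h.isDipathOn.splice_twice (ih (c + 2) (by omega))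
      h.arc_k_zero le_rfl le_rfl (by omega) (by omega) (Nat.zero_le c) (by omega) (by omega))

theorem arc_zero (h : IsGeodesicQT A k P) (r : ℕ) :
    2 * r + 3 ≤ k + 2 → A (P (2 * r + 3)) (P 0) := by
  have h5 := h.five_le
  induction r with
  | zero =>
    intro hr
    exact h.arc_of_dipath (by omega) hr (h.isDipathOn.splice h.arc_last_zero
      hr le_rfl le_rfl (by omega) (Or.inl (by omega)) (by omega))
  | succ r ih =>
    intro hr
    exact h.arc_of_dipath (by omega) hr (h.isDipathOn.splice_twice h.arc_last_two
      (ih (by omega)) hr le_rfl (by omega) (by omega) le_rfl (by omega) (by omega))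

/-- Descending to a vertex of the same parity by a path of length `k - 1`. -/
theorem descend (h : IsGeodesicQT A k P) {i j : ℕ} (hji : j < i) (hi : i ≤ k + 2)
    (hpar : i % 2 = j % 2) : HasDipathWithin A P (Set.Iic (k + 2)) (k - 1) i j := by
  have h5 := h.five_le
  have hodd := Nat.odd_iff.1 h.odd
  have hD := h.isDipathOn
  rcases (show i = j + 2 ∨ i = j + 4 ∨ j + 6 ≤ i by omega) with h2 | h4 | h6
  · rcases le_or_gt i k with hik | hik
    · exact hD.splice h.arc_k_zero hik (by omega) (Nat.zero_le j) (by omega) (Or.inl hji) (by omega)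
    · exact hD.splice h.arc_last_two hi le_rfl (by omega) (by omega) (Or.inl hji) (by omega)
  · exact hD.splice h.arc_last_zero hi le_rfl (Nat.zero_le j) (by omega) (Or.inl hji) (by omega)
  · obtain ⟨c, hc, hjc, hcj⟩ : ∃ c, c % 2 = 0 ∧ j < c ∧ c ≤ j + 2 :=
      ⟨j + 2 - j % 2, by omega, by omega, by omega⟩
    have hlast := h.arc_last ((k - 1 - c) / 2) c (by omega)
    have hzero := h.arc_zero ((c + (i - j) - 8) / 2) (by omega)
    rw [show 2 * ((c + (i - j) - 8) / 2) + 3 = c + (i - j) - 5 by omega] at hzero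
    exact hD.splice_twice hlast hzero hi le_rfl (by omega) (by omega) (Nat.zero_le j) hjc (by omega)

theorem dAdj_of_arc_to (h : IsGeodesicQT A k P) {x : V} (hx : ∀ t ≤ k + 2, P t ≠ x) {i j : ℕ}
    (hp : HasDipathWithin A P (Set.Iic (k + 2)) (k - 1) i j) (hA : A x (P i)) :
    DAdj A x (P j) := by
  have := hp.hasDipath_cons h.isDipathOn hx hA
  rw [Nat.sub_add_cancel (by linarith [h.five_le])] at this
  exact h.quasiTransitive.dAdj this

theorem dAdj_of_arc_from (h : IsGeodesicQT A k P) {x : V} (hx : ∀ t ≤ k + 2, P t ≠ x) {i j : ℕ}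
    (hp : HasDipathWithin A P (Set.Iic (k + 2)) (k - 1) i j) (hA : A (P j) x) :
    DAdj A x (P i) := by
  have := hp.hasDipath_concat h.isDipathOn hx hA
  rw [Nat.sub_add_cancel (by linarith [h.five_le])] at this
  exact (h.quasiTransitive.dAdj this).symm

/-- A vertex off the path that is adjacent to some vertex of the parity class of `o` is adjacent
to the whole class, or is dominated by its last two vertices and dominates its first two. -/
theorem dAdj_parity_class (h : IsGeodesicQT A k P) {x : V} (hx : ∀ t ≤ k + 2, P t ≠ x) {o : ℕ}
    (ho : o < 2) (hadj : ∃ i ≤ k + 2, i % 2 = o ∧ DAdj A x (P i)) :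
    (∀ i ≤ k + 2, i % 2 = o → DAdj A x (P i)) ∨
    ((∀ i ≤ k + 2, i % 2 = o → k - 1 + o ≤ i → A (P i) x ∧ ¬ A x (P i)) ∧
      ∀ i ≤ k + 2, i % 2 = o → i ≤ o + 2 → A x (P i) ∧ ¬ A (P i) x) := by
  have h5 := h.five_le
  have hodd := Nat.odd_iff.1 h.odd
  by_contra hcon
  rw [not_or] at hcon
  obtain ⟨hne, hcon⟩ := hcon
  push Not at hne
  obtain ⟨m, hm, hmo, hmx⟩ := hne
  have down {i j : ℕ} (hj : j % 2 = o) (hi : i % 2 = o) (hji : j < i) (hik : i ≤ k + 2) :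
      (A x (P i) → DAdj A x (P j)) ∧ (A (P j) x → DAdj A x (P i)) :=
    ⟨h.dAdj_of_arc_to hx (h.descend hji hik (by omega)),
      h.dAdj_of_arc_from hx (h.descend hji hik (by omega))⟩
  have up {i j : ℕ} (hij : i + (k - 1) = j) (hj : j ≤ k + 2) :
      (A x (P i) → DAdj A x (P j)) ∧ (A (P j) x → DAdj A x (P i)) :=
    ⟨h.dAdj_of_arc_to hx (h.segment hij hj), h.dAdj_of_arc_from hx (h.segment hij hj)⟩
  have below {i : ℕ} (hi : i % 2 = o) (him : i < m) : ¬ A (P i) x := fun hA =>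
    hmx ((down hi hmo him hm).2 hA)
  have above {i : ℕ} (hi : i % 2 = o) (hik : i ≤ k + 2) (him : m < i) : ¬ A x (P i) := fun hA =>
    hmx ((down hmo hi him hik).1 hA)
  have ne {i : ℕ} (hA : DAdj A x (P i)) : i ≠ m := fun e => hmx (e ▸ hA)
  obtain ⟨hA₀, hA₁, hB₁, hB₀⟩ : DAdj A x (P o) ∧ DAdj A x (P (o + 2)) ∧
      DAdj A x (P (k - 1 + o)) ∧ DAdj A x (P (k + 1 + o)) := by
    obtain ⟨i, hi, hio, hout | hin⟩ := hadj
    · have h₀ : DAdj A x (P o) := by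
        rcases (show i = o ∨ o < i by omega) with rfl | hoi
        · exact Or.inl hout
        · exact (down (by omega) hio hoi hi).1 hout
      have hne := ne h₀
      have h₁ := (up (j := k - 1 + o) (by omega) (by omega)).1
        (h₀.resolve_right (below (by omega) (by omega)))
      rcases lt_or_gt_of_ne (ne h₁) with hlt | hgt
      · have h₂ := (down (j := o + 2) (by omega) (by omega) (by omega) (by omega)).1
          (h₁.resolve_right (below (by omega) hlt))
        exact ⟨h₀, h₂, h₁, (up (by omega) (by omega)).1
          (h₂.resolve_right (below (by omega) (by omega)))⟩
      · have h₂ := (down (i := k + 1 + o) (by omega) (by omega) (by omega) (by omega)).2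
          (h₁.resolve_left (above (by omega) (by omega) hgt))
        exact ⟨h₀, (up (by omega) (by omega)).2
          (h₂.resolve_left (above (by omega) (by omega) (by omega))), h₁, h₂⟩
    · have h₀ : DAdj A x (P (k + 1 + o)) := by
        rcases (show i = k + 1 + o ∨ i < k + 1 + o by omega) with rfl | hoi
        · exact Or.inr hin
        · exact (down hio (by omega) hoi (by omega)).2 hin
      have hne := ne h₀
      have h₁ := (up (i := o + 2) (by omega) (by omega)).2
        (h₀.resolve_left (above (by omega) (by omega) (by omega)))
      rcases lt_or_gt_of_ne (ne h₁) with hlt | hgt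
      · have h₂ := (down (j := o) (by omega) (by omega) (by omega) (by omega)).1
          (h₁.resolve_right (below (by omega) hlt))
        exact ⟨h₂, h₁, (up (by omega) (by omega)).1
          (h₂.resolve_right (below (by omega) (by omega))), h₀⟩
      · have h₂ := (down (i := k - 1 + o) (by omega) (by omega) (by omega) (by omega)).2
          (h₁.resolve_left (above (by omega) (by omega) hgt))
        exact ⟨(up (by omega) (by omega)).2
          (h₂.resolve_left (above (by omega) (by omega) (by omega))), h₁, h₂, h₀⟩
  have := ne hA₀
  have := ne hA₁
  have := ne hB₁
  have := ne hB₀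
  refine hcon ⟨fun i hi hio hsi => ?_, fun i hi hio hit => ?_⟩
  · have hnot := above hio hi (by omega)
    rcases (show i = k - 1 + o ∨ i = k + 1 + o by omega) with rfl | rfl
    · exact ⟨hB₁.resolve_left hnot, hnot⟩
    · exact ⟨hB₀.resolve_left hnot, hnot⟩
  · have hnot := below hio (by omega)
    rcases (show i = o ∨ i = o + 2 by omega) with rfl | rfl
    · exact ⟨hA₀.resolve_right hnot, hnot⟩
    · exact ⟨hA₁.resolve_right hnot, hnot⟩

end IsGeodesicQT

theorem stmt_10
    {V : Type*} [Fintype V] (A : V → V → Prop) (hirr : Irreflexive A)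
    (k : ℕ) (hk5 : 5 ≤ k) (hkodd : Odd k)
    (hQT : KQuasiTransitive A k) (hstrong : StrongD A)
    (u v : V) (hdist : ∀ m, m < k + 2 → ¬ HasDipath A m u v)
    (P : ℕ → V) (hP : IsDipathOn A (k + 2) P) (hPu : P 0 = u) (hPv : P (k + 2) = v) :
    ∀ x ∈ BSet A (VertsUpTo (k + 2) P),
      ((∃ w ∈ OddVertsUpTo (k + 2) P, DAdj A x w) →
        (∀ w ∈ OddVertsUpTo (k + 2) P, DAdj A x w) ∨
        ∃ s t : ℕ, Odd s ∧ Odd t ∧ 3 ≤ t ∧ t < s ∧ s ≤ k ∧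
          (∀ i : ℕ, Odd i → s ≤ i → i ≤ k + 2 → A (P i) x ∧ ¬ A x (P i)) ∧
          (∀ i : ℕ, Odd i → i ≤ t → A x (P i) ∧ ¬ A (P i) x)) ∧
      ((∃ w ∈ EvenVertsUpTo (k + 2) P, DAdj A x w) →
        (∀ w ∈ EvenVertsUpTo (k + 2) P, DAdj A x w) ∨
        ∃ s t : ℕ, Even s ∧ Even t ∧ 2 ≤ t ∧ t < s ∧ s ≤ k - 1 ∧
          (∀ i : ℕ, Even i → s ≤ i → i ≤ k + 1 → A (P i) x ∧ ¬ A x (P i)) ∧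
          (∀ i : ℕ, Even i → i ≤ t → A x (P i) ∧ ¬ A (P i) x)) := by
  subst hPu hPv
  rintro x ⟨hxP, -, -⟩
  have h : IsGeodesicQT A k P := ⟨hk5, hkodd, hQT, hP, hdist⟩
  have hx : ∀ t ≤ k + 2, P t ≠ x := fun t ht e => hxP ⟨t, ht, e⟩
  have hk := Nat.odd_iff.1 hkodd
  constructor
  · rintro ⟨_, ⟨i, hi, hio, rfl⟩, hadj⟩
    rcases h.dAdj_parity_class hx one_lt_two ⟨i, hi, Nat.odd_iff.1 hio, hadj⟩ with
      hall | ⟨hs, ht⟩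
    · left
      rintro _ ⟨j, hj, hjo, rfl⟩
      exact hall j hj (Nat.odd_iff.1 hjo)
    · exact Or.inr ⟨k, 3, hkodd, by decide, le_rfl, by omega, le_rfl,
        fun j hjo hsj hj => hs j hj (Nat.odd_iff.1 hjo) (by omega),
        fun j hjo hjt => ht j (by omega) (Nat.odd_iff.1 hjo) hjt⟩
  · rintro ⟨_, ⟨i, hi, hie, rfl⟩, hadj⟩
    rcases h.dAdj_parity_class hx zero_lt_two ⟨i, hi, Nat.even_iff.1 hie, hadj⟩ with
      hall | ⟨hs, ht⟩
    · left
      rintro _ ⟨j, hj, hje, rfl⟩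
      exact hall j hj (Nat.even_iff.1 hje)
    · exact Or.inr ⟨k - 1, 2, Nat.even_iff.2 (by omega), even_two, le_rfl, by omega, le_rfl,
        fun j hje hsj hj => hs j (by omega) (Nat.even_iff.1 hje) hsj,
        fun j hje hjt => ht j (by omega) (Nat.even_iff.1 hje) hjt⟩
end

section
/- Suppose the induced subdigraph D[V(P)] is a semicomplete digraph. Then for any x ∈ B, either x is adjacent to every vertex of V(P), or there exist indices t, s with 4 ≤ t+1 < s ≤ k−1 such that {x_s, x_{s+1}, …, x_{k+2}} ↦ x and x ↦ {x_0, x_1, …, x_t}. -/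
variable {V : Type*}

/-- A shortest path has no forward chords. -/
lemma IsDipathOn.not_forward_chord {V : Type*} {A : V → V → Prop} {n : ℕ} {P : ℕ → V}
    (hP : IsDipathOn A n P) (hdist : ∀ m, m < n → ¬ HasDipath A m (P 0) (P n))
    {i j : ℕ} (hij : i + 2 ≤ j) (hj : j ≤ n) : ¬ A (P i) (P j) := by
  intro h
  refine hdist (n - (j - i - 1)) (by omega)
    ⟨fun l => P (if l ≤ i then l else l + (j - i - 1)), ⟨?_, ?_⟩, by simp, ?_⟩
  · intro a b ha hb hab
    have := hP.1 _ _ (by split_ifs <;> omega) (by split_ifs <;> omega) hab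
    split_ifs at this <;> omega
  · intro l hl
    rcases lt_trichotomy l i with hli | rfl | hli
    · simpa only [if_pos hli.le, if_pos (Nat.succ_le_of_lt hli)] using hP.2 l (by omega)
    · have e : l + 1 + (j - l - 1) = j := by omega
      simpa [e] using h
    · have e : l + 1 + (j - i - 1) = l + (j - i - 1) + 1 := by omega
      simp only [if_neg (show ¬ l ≤ i by omega), if_neg (show ¬ l + 1 ≤ i by omega), e]
      exact hP.2 _ (by omega)
  · simp only [if_neg (show ¬ n - (j - i - 1) ≤ i by omega)]
    congr 1
    omega

/-- `g 0, …, g m` is an index sequence in `{0, …, n}` without repetition in which every step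
is either `+1` or a descent by at least two. -/
structure IsIndexPath (n m : ℕ) (g : ℕ → ℕ) : Prop where
  le : ∀ l ≤ m, g l ≤ n
  inj : ∀ a b, a ≤ m → b ≤ m → g a = g b → a = b
  step : ∀ l < m, g (l + 1) = g l + 1 ∨ g (l + 1) + 2 ≤ g l

/-- From any index one can reach any smaller one using exactly `k` of the `k + 3` indices. -/
lemma exists_isIndexPath_of_lt {k i j : ℕ} (hk : 5 ≤ k) (hij : i < j) (hj : j ≤ k + 2) :
    ∃ g, IsIndexPath (k + 2) (k - 1) g ∧ g 0 = j ∧ g (k - 1) = i := by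
  by_cases hfar : i + 5 ≤ j
  · refine ⟨fun l => if l ≤ k + 2 - j then j + l else
      if l + 1 + i < k then l - (k + 3 - j) + (i + 3) else l + 1 + i - k, ⟨?_, ?_, ?_⟩, ?_, ?_⟩
    · intro l hl
      split_ifs <;> omega
    · intro a b ha hb h
      split_ifs at h <;> omega
    · intro l hl
      split_ifs <;> omega
    · simp
    · dsimp only
      split_ifs <;> omega
  · obtain ⟨a, m, ha, hm, hm', hcount⟩ :
        ∃ a m, a ≤ i ∧ j ≤ m ∧ m ≤ k + 2 ∧ m + i + 2 = k + a + j := by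
      rcases le_total i (k - 2) with h | h
      · exact ⟨0, j + k - 2 - i, by omega, by omega, by omega, by omega⟩
      · exact ⟨i - (k - 2), j, by omega, by omega, by omega, by omega⟩
    refine ⟨fun l => if l ≤ m - j then j + l else l - (m - j + 1) + a, ⟨?_, ?_, ?_⟩, ?_, ?_⟩
    · intro l hl
      split_ifs <;> omega
    · intro a b ha hb h
      split_ifs at h <;> omega
    · intro l hl
      split_ifs <;> omega
    · simp
    · dsimp only
      split_ifs <;> omega

lemma isIndexPath_shift {k j : ℕ} (hj : j ≤ 3) (hk : 1 ≤ k) :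
    IsIndexPath (k + 2) (k - 1) (fun l => j + l) :=
  ⟨fun l hl => by omega, fun a b _ _ h => by omega, fun l _ => by omega⟩

/-- An index path gives a path in the digraph, once all descents by at least two are arcs. -/
lemma IsIndexPath.isDipathOn {V : Type*} {A : V → V → Prop} {n m : ℕ} {P : ℕ → V} {g : ℕ → ℕ}
    (hg : IsIndexPath n m g) (hP : IsDipathOn A n P)
    (hback : ∀ i j, i + 2 ≤ j → j ≤ n → A (P j) (P i)) : IsDipathOn A m (fun l => P (g l)) := by
  refine ⟨fun a b ha hb h => hg.inj a b ha hb (hP.1 _ _ (hg.le a ha) (hg.le b hb) h), ?_⟩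
  intro l hl
  have hle := hg.le (l + 1) hl
  rcases hg.step l hl with h | h
  · simp only [h]
    exact hP.2 _ (by omega)
  · exact hback _ _ h (hg.le l hl.le)

/-- Prepending a vertex to a path of length `k - 1`. -/
lemma KQuasiTransitive.dAdj_of_cons {V : Type*} {A : V → V → Prop} {m : ℕ} {x : V} {Q : ℕ → V}
    (hQT : KQuasiTransitive A (m + 1)) (hQ : IsDipathOn A m Q) (hx : ∀ l ≤ m, Q l ≠ x)
    (h : A x (Q 0)) : DAdj A x (Q m) := by
  refine hQT (fun l => Nat.casesOn l x Q) ⟨?_, ?_⟩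
  · rintro (_ | a) (_ | b) ha hb hab
    · rfl
    · exact absurd hab.symm (hx b (by omega))
    · exact absurd hab (hx a (by omega))
    · rw [hQ.1 a b (by omega) (by omega) hab]
  · rintro (_ | l) hl
    · exact h
    · exact hQ.2 l (by omega)

/-- Appending a vertex to a path of length `k - 1`. -/
lemma KQuasiTransitive.dAdj_of_snoc {V : Type*} {A : V → V → Prop} {m : ℕ} {x : V} {Q : ℕ → V}
    (hQT : KQuasiTransitive A (m + 1)) (hQ : IsDipathOn A m Q) (hx : ∀ l ≤ m, Q l ≠ x)
    (h : A (Q m) x) : DAdj A x (Q 0) := by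
  have key := hQT (fun l => if l ≤ m then Q l else x) ⟨?_, ?_⟩
  · simpa [DAdj, or_comm] using key
  · intro a b ha hb hab
    dsimp only at hab
    split_ifs at hab with h₁ h₂ h₂
    · exact hQ.1 a b h₁ h₂ hab
    · exact absurd hab (hx a h₁)
    · exact absurd hab.symm (hx b h₂)
    · omega
  · intro l hl
    rcases Nat.lt_succ_iff_lt_or_eq.1 hl with hlm | rfl
    · simpa only [if_pos hlm.le, if_pos (Nat.succ_le_of_lt hlm)] using hQ.2 l hlm
    · simpa using h

theorem stmt_11
    {V : Type*} [Fintype V] (A : V → V → Prop) (hirr : Irreflexive A)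
    (k : ℕ) (hk5 : 5 ≤ k) (hkodd : Odd k)
    (hQT : KQuasiTransitive A k) (hstrong : StrongD A)
    (u v : V) (hdist : ∀ m, m < k + 2 → ¬ HasDipath A m u v)
    (P : ℕ → V) (hP : IsDipathOn A (k + 2) P) (hPu : P 0 = u) (hPv : P (k + 2) = v)
    (hsemi : SemicompleteOn A (VertsUpTo (k + 2) P)) :
    ∀ x ∈ BSet A (VertsUpTo (k + 2) P),
      (∀ w ∈ VertsUpTo (k + 2) P, DAdj A x w) ∨
      ∃ t s : ℕ, 4 ≤ t + 1 ∧ t + 1 < s ∧ s ≤ k - 1 ∧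
        (∀ i : ℕ, s ≤ i → i ≤ k + 2 → A (P i) x ∧ ¬ A x (P i)) ∧
        (∀ i ≤ t, A x (P i) ∧ ¬ A (P i) x) := by
  subst hPu hPv
  have hback : ∀ i j, i + 2 ≤ j → j ≤ k + 2 → A (P j) (P i) := by
    intro i j hij hj
    have hne : P j ≠ P i := fun h => by
      have := hP.1 j i hj (by omega) h
      omega
    exact (hsemi (P j) ⟨j, hj, rfl⟩ (P i) ⟨i, by omega, rfl⟩ hne).resolve_right
      (hP.not_forward_chord hdist hij hj)
  rintro x ⟨hxP, hxI, hxW⟩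
  have hk : k - 1 + 1 = k := by omega
  rw [← hk] at hQT
  have hne : ∀ i ≤ k + 2, P i ≠ x := fun i hi h => hxP ⟨i, hi, h⟩
  have out_adj : ∀ g, IsIndexPath (k + 2) (k - 1) g → A x (P (g 0)) →
      DAdj A x (P (g (k - 1))) := fun g hg h =>
    hQT.dAdj_of_cons (hg.isDipathOn hP hback) (fun l hl => hne _ (hg.le l hl)) h
  have in_adj : ∀ g, IsIndexPath (k + 2) (k - 1) g → A (P (g (k - 1))) x →
      DAdj A x (P (g 0)) := fun g hg h =>
    hQT.dAdj_of_snoc (hg.isDipathOn hP hback) (fun l hl => hne _ (hg.le l hl)) h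
  have out_lt : ∀ i j, i < j → j ≤ k + 2 → A x (P j) → DAdj A x (P i) := by
    intro i j hij hj h
    obtain ⟨g, hg, rfl, rfl⟩ := exists_isIndexPath_of_lt hk5 hij hj
    exact out_adj g hg h
  have in_lt : ∀ i j, i < j → j ≤ k + 2 → A (P i) x → DAdj A x (P j) := by
    intro i j hij hj h
    obtain ⟨g, hg, rfl, rfl⟩ := exists_isIndexPath_of_lt hk5 hij hj
    exact in_adj g hg h
  have out_shift : ∀ j ≤ 3, A x (P j) → DAdj A x (P (j + (k - 1))) := fun j hj h =>
    out_adj _ (isIndexPath_shift hj (by omega)) h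
  have in_shift : ∀ j ≤ 3, A (P (j + (k - 1))) x → DAdj A x (P j) := fun j hj h =>
    in_adj _ (isIndexPath_shift hj (by omega)) h
  refine or_iff_not_imp_left.2 fun hall => ?_
  push Not at hall
  obtain ⟨_, ⟨q, hq, rfl⟩, hxq⟩ := hall
  have out_below : ∀ j ≤ k + 2, A x (P j) → j < q := by
    intro j hj h
    rcases lt_trichotomy j q with h' | rfl | h'
    · exact h'
    · exact absurd (Or.inl h) hxq
    · exact absurd (out_lt q j h' hj h) hxq
  have in_above : ∀ j ≤ k + 2, A (P j) x → q < j := by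
    intro j hj h
    rcases lt_trichotomy j q with h' | rfl | h'
    · exact absurd (in_lt j q h' hq h) hxq
    · exact absurd (Or.inr h) hxq
    · exact h'
  have out_of_adj : ∀ j < q, DAdj A x (P j) → A x (P j) := fun j hj h =>
    h.resolve_right fun h' => by
      have := in_above j (by omega) h'
      omega
  have in_of_adj : ∀ j, q < j → j ≤ k + 2 → DAdj A x (P j) → A (P j) x := fun j hj hj' h =>
    h.resolve_left fun h' => by
      have := out_below j hj' h'
      omega
  have out_down : ∀ i j, i ≤ j → j ≤ k + 2 → A x (P j) → A x (P i) := by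
    intro i j hij hj h
    rcases hij.eq_or_lt with rfl | hij
    · exact h
    · exact out_of_adj i (hij.trans (out_below j hj h)) (out_lt i j hij hj h)
  have in_up : ∀ i j, i ≤ j → j ≤ k + 2 → A (P i) x → A (P j) x := by
    intro i j hij hj h
    rcases hij.eq_or_lt with rfl | hij
    · exact h
    · exact in_of_adj j ((in_above i (by omega) h).trans hij) hj (in_lt i j hij hj h)
  obtain ⟨j₀, hj₀, hout⟩ : ∃ j ≤ k + 2, A x (P j) := by
    by_contra! hcon
    exact hxW ⟨hxP, by rintro _ ⟨i, hi, rfl⟩; exact hcon i hi⟩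
  obtain ⟨j₁, hj₁, hin⟩ : ∃ j ≤ k + 2, A (P j) x := by
    by_contra! hcon
    exact hxI ⟨hxP, by rintro _ ⟨i, hi, rfl⟩; exact hcon i hi⟩
  have adj_last : DAdj A x (P (k - 1)) := by
    simpa using out_shift 0 (by omega) (out_down 0 j₀ (by omega) hj₀ hout)
  have adj_three : DAdj A x (P 3) :=
    in_shift 3 le_rfl (in_up j₁ _ (by omega) (by omega) hin)
  have hq0 := out_below j₀ hj₀ hout
  have hq1 := in_above j₁ hj₁ hin
  have hq3 : 3 < q := by
    by_contra! hle
    rcases hle.eq_or_lt with rfl | hlt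
    · exact hxq adj_three
    · have h3 := in_of_adj 3 hlt (by omega) adj_three
      exact hxq (in_shift q hle (in_up 3 _ (by omega) (by omega) h3))
  have hqk : q < k - 1 := by
    by_contra! hle
    rcases hle.eq_or_lt with rfl | hlt
    · exact hxq adj_last
    · have hl := out_of_adj (k - 1) hlt adj_last
      have := out_shift (q - (k - 1)) (by omega) (out_down _ (k - 1) (by omega) (by omega) hl)
      rw [Nat.sub_add_cancel hle] at this
      exact hxq this
  refine ⟨3, k - 1, le_rfl, by omega, le_rfl, fun i hi hi' => ⟨?_, fun h => ?_⟩,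
    fun i hi => ⟨?_, fun h => ?_⟩⟩
  · exact in_up (k - 1) i hi hi' (in_of_adj _ hqk (by omega) adj_last)
  · have := out_below i hi' h
    omega
  · exact out_down i 3 hi (by omega) (out_of_adj _ hq3 adj_three)
  · have := in_above i (by omega) h
    omega
end

section
/- Suppose the induced subdigraph D[V(P)] is a semicomplete digraph. Then for any x ∈ I, x ↦ V(P), and for any y ∈ W, V(P) ↦ y. -/
variable {V : Type*}

namespace IsDipathOn

variable {A : V → V → Prop}

theorem window {n m s : ℕ} {x : ℕ → V} (h : IsDipathOn A n x) (hs : s + m ≤ n) :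
    IsDipathOn A m (fun t => x (s + t)) := by
  refine ⟨fun i j hi hj hij => ?_, fun i hi => h.2 (s + i) (by omega)⟩
  have := h.1 _ _ (by omega) (by omega) hij
  omega

theorem single (x : V) : IsDipathOn A 0 (fun _ => x) :=
  ⟨fun i j hi hj _ => by omega, fun i hi => by omega⟩

/-- Joining two disjoint dipaths by an arc. -/
theorem concat {p q : ℕ} {x y : ℕ → V} (hx : IsDipathOn A p x) (hy : IsDipathOn A q y)
    (hxy : A (x p) (y 0)) (hdisj : ∀ i ≤ p, ∀ j ≤ q, x i ≠ y j) :
    IsDipathOn A (p + 1 + q) (fun t => if t ≤ p then x t else y (t - (p + 1))) := by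
  constructor
  · intro i j hi hj hij
    by_cases h1 : i ≤ p <;> by_cases h2 : j ≤ p <;> simp only [h1, h2, if_true, if_false] at hij
    · exact hx.1 i j h1 h2 hij
    · exact (hdisj _ h1 _ (by omega) hij).elim
    · exact (hdisj _ h2 _ (by omega) hij.symm).elim
    · have := hy.1 _ _ (by omega) (by omega) hij
      omega
  · intro i hi
    rcases lt_trichotomy i p with h | rfl | h
    · simpa [h.le, Nat.succ_le_of_lt h] using hx.2 i h
    · simpa using hxy
    · have := hy.2 (i - (p + 1)) (by omega)
      have e : i - (p + 1) + 1 = i + 1 - (p + 1) := by omega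
      rw [e] at this
      simpa [show ¬ i ≤ p by omega, show ¬ i + 1 ≤ p by omega] using this

theorem reverse {n : ℕ} {x : ℕ → V} (h : IsDipathOn A n x) :
    IsDipathOn (fun a b => A b a) n (fun t => x (n - t)) := by
  refine ⟨fun i j hi hj hij => ?_, fun i hi => ?_⟩
  · have := h.1 _ _ (by omega) (by omega) hij
    omega
  · have := h.2 (n - (i + 1)) (by omega)
    rwa [show n - (i + 1) + 1 = n - i by omega] at this

/-- A dipath with a forward chord can be shortened. -/
theorem exists_shorter_of_chord {n i j : ℕ} {x : ℕ → V} (h : IsDipathOn A n x)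
    (hij : i + 2 ≤ j) (hj : j ≤ n) (hA : A (x i) (x j)) :
    ∃ m < n, HasDipath A m (x 0) (x n) := by
  have hc := (h.window (s := 0) (m := i) (by omega)).concat
    (h.window (s := j) (m := n - j) (by omega)) (by simpa using hA) (by
      intro a ha b hb hab
      have := h.1 _ _ (by omega) (by omega) hab
      omega)
  refine ⟨_, ?_, _, hc, ?_, ?_⟩
  · omega
  · simp
  · simp only [show ¬ (i + 1 + (n - j) ≤ i) by omega, if_false]
    congr 1
    omega

/-- A dipath closed by an arc from its last to its first vertex can be traversed cyclically. -/
theorem cyclic_window {n : ℕ} {P : ℕ → V} (h : IsDipathOn A n P) (hclose : A (P n) (P 0))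
    (s : ℕ) {m : ℕ} (hm : m ≤ n) : IsDipathOn A m (fun t => P ((s + t) % (n + 1))) := by
  constructor
  · intro i j hi hj hij
    have hmod := h.1 _ _ (Nat.lt_succ_iff.mp (Nat.mod_lt _ (by omega)))
      (Nat.lt_succ_iff.mp (Nat.mod_lt _ (by omega))) hij
    have hmod' : i % (n + 1) = j % (n + 1) := Nat.ModEq.add_left_cancel' s hmod
    rwa [Nat.mod_eq_of_lt (by omega), Nat.mod_eq_of_lt (by omega)] at hmod'
  · intro i hi
    have hlt : (s + i) % (n + 1) < n + 1 := Nat.mod_lt _ (by omega)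
    have hsucc : (s + (i + 1)) % (n + 1) = ((s + i) % (n + 1) + 1) % (n + 1) := by
      rw [Nat.mod_add_mod, add_assoc]
    simp only [hsucc]
    rcases Nat.lt_succ_iff_lt_or_eq.mp hlt with hl | he
    · rw [Nat.mod_eq_of_lt (a := (s + i) % (n + 1) + 1) (by omega)]
      exact h.2 _ hl
    · rw [he, Nat.mod_self]
      exact hclose

end IsDipathOn

section Dominating

variable {A : V → V → Prop} {k : ℕ} {P : ℕ → V}

theorem mem_vertsUpTo {n i : ℕ} (hi : i ≤ n) : P i ∈ VertsUpTo n P := ⟨i, hi, rfl⟩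

theorem mod_mem_vertsUpTo (n s : ℕ) : P (s % (n + 1)) ∈ VertsUpTo n P :=
  mem_vertsUpTo (Nat.lt_succ_iff.mp (Nat.mod_lt _ (by omega)))

/-- The endpoint of a dipath of length `k - 1` inside `S` that starts at an out-neighbour of a
vertex `x ∈ ISet A S` is again an out-neighbour of `x`. -/
theorem KQuasiTransitive.arc_of_mem_ISet (hQT : KQuasiTransitive A k) {S : Set V} {x : V}
    (hx : x ∈ ISet A S) {q : ℕ} (hq : q + 1 = k) {z : ℕ → V} (hz : IsDipathOn A q z)
    (hzS : ∀ t ≤ q, z t ∈ S) (hxz : A x (z 0)) : A x (z q) := by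
  have hc := (IsDipathOn.single x).concat hz hxz
    (fun i _ j hj he => hx.1 (by simpa [he] using hzS j hj))
  rw [show 0 + 1 + q = k by omega] at hc
  have hadj := hQT _ hc
  simp only [le_refl, if_true, show ¬ k ≤ 0 by omega, if_false,
    show k - (0 + 1) = q by omega] at hadj
  exact hadj.resolve_right (hx.2 _ (hzS q le_rfl))

/-- A vertex of `ISet` with one out-neighbour on the path dominates the whole path. -/
theorem arc_all_of_arc (hk5 : 5 ≤ k) (hQT : KQuasiTransitive A k) (hP : IsDipathOn A (k + 2) P)
    (hback : ∀ i j, i + 2 ≤ j → j ≤ k + 2 → A (P j) (P i))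
    {x : V} (hx : x ∈ ISet A (VertsUpTo (k + 2) P)) {i : ℕ} (hi : i ≤ k + 2) (hxi : A x (P i))
    {j : ℕ} (hj : j ≤ k + 2) : A x (P j) := by
  have hsplice : ∀ a b i, a + b = 3 → i + a ≤ k + 2 → b + 1 ≤ i → A x (P i) →
      A x (P (i - 1)) := by
    intro a b i hab hia hbi hA
    have hc := (hP.window (s := i) (m := k + 2 - a - i) (by omega)).concat
      (hP.window (s := b) (m := i - 1 - b) (by omega)) (hback _ _ (by omega) (by omega)) (by
        intro s hs t ht he
        have := hP.1 _ _ (by omega) (by omega) he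
        omega)
    have hres := hQT.arc_of_mem_ISet hx (by omega) hc (by
      intro t ht
      split_ifs
      · exact mem_vertsUpTo (by omega)
      · exact mem_vertsUpTo (by omega)) (by simpa using hA)
    simp only [show ¬ (k + 2 - a - i + 1 + (i - 1 - b) ≤ k + 2 - a - i) by omega,
      if_false] at hres
    rwa [show b + (k + 2 - a - i + 1 + (i - 1 - b) - (k + 2 - a - i + 1)) = i - 1 by omega] at hres
  have hpred : ∀ i, i + 1 ≤ k + 2 → A x (P (i + 1)) → A x (P i) := by
    intro i hi hA
    rcases le_or_gt (i + 1 + 3) (k + 2) with h | h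
    · exact hsplice 3 0 (i + 1) rfl h (by omega) hA
    · exact hsplice 0 3 (i + 1) rfl hi (by omega) hA
  have hdown : ∀ j d, j + d ≤ k + 2 → A x (P (j + d)) → A x (P j) := by
    intro j d
    induction d with
    | zero => exact fun _ h => h
    | succ d ih => exact fun h hA => ih (by omega) (hpred (j + d) (by omega) hA)
  have hup : ∀ i ≤ 3, A x (P i) → A x (P (i + (k - 1))) := fun i hi3 hA =>
    hQT.arc_of_mem_ISet (z := fun t => P (i + t)) hx (by omega) (hP.window (by omega))
      (fun t ht => mem_vertsUpTo (by omega)) hA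
  have h0 : A x (P 0) := hdown 0 i (by omega) (by simpa using hxi)
  have h3 : A x (P 3) := hdown 3 (k - 4) (by omega) (by
    have := hup 0 (by omega) h0
    rwa [show 0 + (k - 1) = 3 + (k - 4) by omega] at this)
  have hlast := hup 3 le_rfl h3
  exact hdown j (k + 2 - j) (by omega) (by
    rwa [show 3 + (k - 1) = j + (k + 2 - j) by omega] at hlast)

/-- If an end-closed path `P` sends an arc to the start of a short dipath `z` outside `P`, then the
end of `z` is adjacent to `P`. -/
theorem exists_adj_of_arc_from (hQT : KQuasiTransitive A k) (hP : IsDipathOn A (k + 2) P)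
    (hclose : A (P (k + 2)) (P 0)) {q a : ℕ} (hq : q + 1 ≤ k) {z : ℕ → V}
    (hz : IsDipathOn A q z) (hzS : ∀ t ≤ q, z t ∉ VertsUpTo (k + 2) P)
    (ha : a ≤ k + 2) (haz : A (P a) (z 0)) :
    ∃ w ∈ VertsUpTo (k + 2) P, DAdj A w (z q) := by
  have hc := (hP.cyclic_window hclose (a + (k + 2 + 1) - (k - q - 1)) (m := k - q - 1)
    (by omega)).concat hz (by
      rw [show a + (k + 2 + 1) - (k - q - 1) + (k - q - 1) = a + (k + 2 + 1) by omega,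
        Nat.add_mod_right, Nat.mod_eq_of_lt (by omega)]
      exact haz) (fun i _ j hj he => hzS j hj (he ▸ mod_mem_vertsUpTo _ _))
  rw [show k - q - 1 + 1 + q = k by omega] at hc
  have hadj := hQT _ hc
  simp only [Nat.zero_le, if_true, show ¬ k ≤ k - q - 1 by omega, if_false,
    show k - (k - q - 1 + 1) = q by omega] at hadj
  exact ⟨_, mod_mem_vertsUpTo _ _, hadj⟩

/-- If a short dipath `z` outside an end-closed path `P` ends with an arc into `P`, then the
start of `z` is adjacent to `P`. -/
theorem exists_adj_of_arc_to (hQT : KQuasiTransitive A k) (hP : IsDipathOn A (k + 2) P)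
    (hclose : A (P (k + 2)) (P 0)) {q a : ℕ} (hq : q + 1 ≤ k) {z : ℕ → V}
    (hz : IsDipathOn A q z) (hzS : ∀ t ≤ q, z t ∉ VertsUpTo (k + 2) P)
    (ha : a ≤ k + 2) (hza : A (z q) (P a)) :
    ∃ w ∈ VertsUpTo (k + 2) P, DAdj A (z 0) w := by
  have hc := hz.concat (hP.cyclic_window hclose a (m := k - q - 1) (by omega)) (by
      rw [add_zero, Nat.mod_eq_of_lt (by omega)]
      exact hza) (fun i hi j _ he => hzS i hi (he ▸ mod_mem_vertsUpTo _ _))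
  rw [show q + 1 + (k - q - 1) = k by omega] at hc
  have hadj := hQT _ hc
  simp only [Nat.zero_le, if_true, show ¬ k ≤ q by omega, if_false] at hadj
  exact ⟨_, mod_mem_vertsUpTo _ _, hadj⟩

/-- A vertex of `ISet` has an out-neighbour on the path. -/
theorem exists_arc_of_mem_ISet (hk5 : 5 ≤ k) (hQT : KQuasiTransitive A k)
    (hstrong : StrongD A) (hP : IsDipathOn A (k + 2) P) (hclose : A (P (k + 2)) (P 0))
    {x : V} (hx : x ∈ ISet A (VertsUpTo (k + 2) P)) :
    ∃ i ≤ k + 2, A x (P i) := by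
  classical
  have hex : ∃ d, ∃ w ∈ VertsUpTo (k + 2) P, HasDipath A d x w := by
    obtain ⟨d, hd⟩ := hstrong x (P 0)
    exact ⟨d, _, mem_vertsUpTo (Nat.zero_le _), hd⟩
  obtain ⟨d, ⟨w, hw, y, hy, hy0, hyd⟩, hmin⟩ : ∃ d,
      (∃ w ∈ VertsUpTo (k + 2) P, HasDipath A d x w) ∧
      ∀ m < d, ∀ w ∈ VertsUpTo (k + 2) P, ¬ HasDipath A m x w :=
    ⟨Nat.find hex, Nat.find_spec hex, fun m hm w hw h => Nat.find_min hex hm ⟨w, hw, h⟩⟩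
  obtain ⟨e, he, rfl⟩ := hw
  have hout : ∀ t < d, y t ∉ VertsUpTo (k + 2) P := fun t ht hmem =>
    hmin t ht _ hmem ⟨_, hy.window (s := 0) (by omega), by simpa using hy0, by simp⟩
  have hnochord : ∀ i j, i + 2 ≤ j → j ≤ d → ¬ A (y i) (y j) := by
    intro i j hij hj hA
    obtain ⟨m, hm, hdip⟩ := hy.exists_shorter_of_chord hij hj hA
    exact hmin m hm _ (mem_vertsUpTo he) (hy0 ▸ hyd ▸ hdip)
  have hnoarc : ∀ t, t + 2 ≤ d → ∀ w ∈ VertsUpTo (k + 2) P, ¬ A (y t) w := by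
    intro t ht w hw hA
    have hc := (hy.window (s := 0) (m := t) (by omega)).concat (IsDipathOn.single w)
      (by simpa using hA) (fun i hi j _ hij => hout (0 + i) (by omega) (hij ▸ hw))
    exact hmin _ (by omega) w hw ⟨_, hc, by simpa using hy0, by simp⟩
  have hd0 : d ≠ 0 := by
    rintro rfl
    exact hx.1 (hy0 ▸ hyd ▸ mem_vertsUpTo he)
  rcases (show d = 1 ∨ 2 ≤ d by omega) with rfl | hd2
  · have := hy.2 0 (by omega)
    rw [hy0, zero_add, hyd] at this
    exact ⟨e, he, this⟩
  exfalso
  have hin : ∀ m, 2 ≤ m → m ≤ d → ∃ a ≤ k + 2, A (P a) (y (d - m)) := by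
    intro m
    induction m using Nat.strong_induction_on with
    | _ m ih =>
      intro hm2 hmd
      rcases le_or_gt m k with hmk | hmk
      · have hlast := hy.2 (d - m + (m - 1)) (by omega)
        rw [show d - m + (m - 1) + 1 = d by omega, hyd] at hlast
        obtain ⟨w, hw, hadj⟩ := exists_adj_of_arc_to hQT hP hclose (by omega)
          (hy.window (s := d - m) (m := m - 1) (by omega))
          (fun t ht => hout _ (by omega)) he hlast
        have harc := hadj.resolve_left (hnoarc _ (by omega) w hw)
        obtain ⟨a, ha, rfl⟩ := hw
        exact ⟨a, ha, harc⟩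
      · have hjump : A (y (d - m + k)) (y (d - m)) :=
          (hQT _ (hy.window (s := d - m) (m := k) (by omega))).resolve_left
            (hnochord _ _ (by omega) (by omega))
        obtain ⟨s, r, a, hr, hs2, ha, hsr, haz⟩ : ∃ s r a, r ≤ 1 ∧ d - m + 2 ≤ s ∧ a ≤ k + 2 ∧
            s + r = d - m + k ∧ A (P a) (y s) := by
          rcases (show m = k + 1 ∨ k + 2 ≤ m by omega) with rfl | h
          · obtain ⟨a, ha, hA⟩ := ih 2 (by omega) le_rfl hd2
            exact ⟨d - 2, 1, a, le_rfl, by omega, ha, by omega, hA⟩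
          · obtain ⟨a, ha, hA⟩ := ih (m - k) (by omega) (by omega) (by omega)
            exact ⟨d - (m - k), 0, a, by omega, by omega, ha, by omega, hA⟩
        have hc := (hy.window (s := s) (m := r) (by omega)).concat
          (IsDipathOn.single (y (d - m))) (by simpa only [hsr] using hjump) (by
            intro i hi j _ hij
            have := hy.1 _ _ (by omega) (by omega) hij
            omega)
        obtain ⟨w, hw, hadj⟩ := exists_adj_of_arc_from hQT hP hclose (by omega) hc (by
          intro t ht
          split_ifs
          · exact hout _ (by omega)
          · exact hout _ (by omega)) ha (by simpa using haz)
        simp only [show ¬ r + 1 + 0 ≤ r by omega, if_false] at hadj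
        have harc := hadj.resolve_right (hnoarc _ (by omega) w hw)
        obtain ⟨b, hb, rfl⟩ := hw
        exact ⟨b, hb, harc⟩
  obtain ⟨a, ha, hA⟩ := hin d hd2 le_rfl
  rw [Nat.sub_self, hy0] at hA
  exact hx.2 _ (mem_vertsUpTo ha) hA

/-- Every vertex of `ISet` dominates a path all of whose backward arcs are present. -/
theorem arc_of_mem_ISet (hk5 : 5 ≤ k) (hQT : KQuasiTransitive A k)
    (hstrong : StrongD A) (hP : IsDipathOn A (k + 2) P)
    (hback : ∀ i j, i + 2 ≤ j → j ≤ k + 2 → A (P j) (P i))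
    {x : V} (hx : x ∈ ISet A (VertsUpTo (k + 2) P)) {j : ℕ} (hj : j ≤ k + 2) :
    A x (P j) := by
  obtain ⟨i, hi, hxi⟩ := exists_arc_of_mem_ISet hk5 hQT hstrong hP
    (hback 0 (k + 2) (by omega) le_rfl) hx
  exact arc_all_of_arc hk5 hQT hP hback hx hi hxi hj

theorem KQuasiTransitive.reverse (hQT : KQuasiTransitive A k) :
    KQuasiTransitive (fun a b => A b a) k := by
  intro x hx
  have := hQT _ hx.reverse
  simpa [DAdj] using this

theorem StrongD.reverse (h : StrongD A) : StrongD (fun a b => A b a) := by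
  intro u v
  obtain ⟨n, x, hx, h0, hn⟩ := h v u
  exact ⟨n, _, hx.reverse, by simpa using hn, by simpa using h0⟩

theorem vertsUpTo_reverse (n : ℕ) (P : ℕ → V) :
    VertsUpTo n (fun t => P (n - t)) = VertsUpTo n P := by
  ext w
  constructor
  · rintro ⟨i, hi, rfl⟩
    exact ⟨n - i, by omega, rfl⟩
  · rintro ⟨i, hi, rfl⟩
    exact ⟨n - i, by omega, by simp only [Nat.sub_sub_self hi]⟩

end Dominating

theorem stmt_12
    {V : Type*} [Fintype V] (A : V → V → Prop) (hirr : Irreflexive A)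
    (k : ℕ) (hk5 : 5 ≤ k) (hkodd : Odd k)
    (hQT : KQuasiTransitive A k) (hstrong : StrongD A)
    (u v : V) (hdist : ∀ m, m < k + 2 → ¬ HasDipath A m u v)
    (P : ℕ → V) (hP : IsDipathOn A (k + 2) P) (hPu : P 0 = u) (hPv : P (k + 2) = v)
    (hsemi : SemicompleteOn A (VertsUpTo (k + 2) P)) :
    (∀ x ∈ ISet A (VertsUpTo (k + 2) P), ∀ w ∈ VertsUpTo (k + 2) P,
      A x w ∧ ¬ A w x) ∧
    (∀ y ∈ WSet A (VertsUpTo (k + 2) P), ∀ w ∈ VertsUpTo (k + 2) P,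
      A w y ∧ ¬ A y w) := by
  have hback : ∀ i j, i + 2 ≤ j → j ≤ k + 2 → A (P j) (P i) := by
    intro i j hij hj
    have hne : P i ≠ P j := fun h => by
      have := hP.1 _ _ (by omega) hj h
      omega
    refine (hsemi _ (mem_vertsUpTo (by omega)) _ (mem_vertsUpTo hj) hne).resolve_left fun hA => ?_
    obtain ⟨m, hm, hdip⟩ := hP.exists_shorter_of_chord hij hj hA
    exact hdist m hm (hPu ▸ hPv ▸ hdip)
  constructor
  · rintro x hx w ⟨j, hj, rfl⟩
    exact ⟨arc_of_mem_ISet hk5 hQT hstrong hP hback hx hj, hx.2 _ (mem_vertsUpTo hj)⟩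
  · rintro y hy w ⟨j, hj, rfl⟩
    refine ⟨?_, hy.2 _ (mem_vertsUpTo hj)⟩
    have hy' : y ∈ ISet (fun a b => A b a)
        (VertsUpTo (k + 2) (fun t => P (k + 2 - t))) := by
      rw [vertsUpTo_reverse]
      exact hy
    have := arc_of_mem_ISet hk5 hQT.reverse hstrong.reverse hP.reverse
      (fun i j hij hj => hback _ _ (by omega) (by omega)) hy' (Nat.sub_le (k + 2) j)
    simpa only [Nat.sub_sub_self hj] using this
end

section
/- If the induced subdigraph D[V(P)] is a semicomplete bipartite digraph, then the induced subdigraph D[B] is either a semicomplete bipartite digraph or an empty digraph (a digraph with no arcs). -/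
variable {V : Type*}

/-- The index arcs guaranteed in `D[V(P)]`: one step forward, or an odd jump of at least `3` back. -/
def IndexArc (N i j : ℕ) : Prop :=
  i ≤ N ∧ j ≤ N ∧ (j = i + 1 ∨ (j + 3 ≤ i ∧ (i + j) % 2 = 1))

/-- The properties of the path `P` that are used to study the vertices outside of it. -/
structure BipartitePath (A : V → V → Prop) (k : ℕ) (P : ℕ → V) : Prop where
  five_le : 5 ≤ k
  odd : k % 2 = 1
  quasi : KQuasiTransitive A k
  inj : ∀ i j, i ≤ k + 2 → j ≤ k + 2 → P i = P j → i = j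
  arc : ∀ i j, IndexArc (k + 2) i j → A (P i) (P j)
  nonadj : ∀ i j, i ≤ k + 2 → j ≤ k + 2 → (i + j) % 2 = 0 → ¬ DAdj A (P i) (P j)
  short : ∀ b ∉ VertsUpTo (k + 2) P, ∀ i j, i ≤ k + 2 → j ≤ k + 2 →
    A (P i) b → A b (P j) → j ≤ i + 2

/-- The path `P 0, …, P N` with `b` and `c` placed at the indices `N + 1` and beyond. -/
def extendPath (N : ℕ) (P : ℕ → V) (b c : V) (i : ℕ) : V :=
  if i ≤ N then P i else if i = N + 1 then b else c

section extendPath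

variable {N : ℕ} {P : ℕ → V} {b c : V}

theorem extendPath_of_le {i : ℕ} (h : i ≤ N) : extendPath N P b c i = P i := by
  simp [extendPath, h]

theorem extendPath_fst : extendPath N P b c (N + 1) = b := by
  simp [extendPath]

theorem extendPath_snd : extendPath N P b c (N + 2) = c := by
  simp [extendPath]

theorem extendPath_inj (hP : ∀ i j, i ≤ N → j ≤ N → P i = P j → i = j)
    (hb : b ∉ VertsUpTo N P) (hc : c ∉ VertsUpTo N P) (hbc : b ≠ c) {i j : ℕ}
    (hi : i ≤ N + 2) (hj : j ≤ N + 2) (h : extendPath N P b c i = extendPath N P b c j) :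
    i = j := by
  have hb' : ∀ i ≤ N, P i ≠ b := fun i hi e => hb ⟨i, hi, e⟩
  have hc' : ∀ i ≤ N, P i ≠ c := fun i hi e => hc ⟨i, hi, e⟩
  unfold extendPath at h
  grind

end extendPath

namespace BipartitePath

variable {A : V → V → Prop} {k : ℕ} {P : ℕ → V} {b c : V}

theorem dAdj_of_indexPath_two (H : BipartitePath A k P)
    (hb : b ∉ VertsUpTo (k + 2) P) (hc : c ∉ VertsUpTo (k + 2) P) (hbc : b ≠ c)
    (E : ℕ → ℕ → Prop)
    (hE : ∀ i j, E i j → A (extendPath (k + 2) P b c i) (extendPath (k + 2) P b c j))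
    (f : ℕ → ℕ) (hf : ∀ n ≤ k, f n ≤ k + 4)
    (hinj : ∀ m n, m ≤ k → n ≤ k → f m = f n → m = n)
    (harc : ∀ n < k, IndexArc (k + 2) (f n) (f (n + 1)) ∨ E (f n) (f (n + 1))) :
    DAdj A (extendPath (k + 2) P b c (f 0)) (extendPath (k + 2) P b c (f k)) := by
  refine H.quasi (fun n => extendPath (k + 2) P b c (f n)) ⟨?_, ?_⟩
  · intro m n hm hn h
    exact hinj m n hm hn (extendPath_inj H.inj hb hc hbc (hf m hm) (hf n hn) h)
  · intro n hn
    rcases harc n hn with h | h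
    · have := H.arc _ _ h
      simpa only [extendPath_of_le h.1, extendPath_of_le h.2.1] using this
    · exact hE _ _ h

/-- The version of `dAdj_of_indexPath_two` for a single outer vertex. -/
theorem dAdj_of_indexPath (H : BipartitePath A k P) (hb : b ∉ VertsUpTo (k + 2) P)
    (E : ℕ → ℕ → Prop)
    (hE : ∀ i j, E i j → A (extendPath (k + 2) P b b i) (extendPath (k + 2) P b b j))
    (f : ℕ → ℕ) (hf : ∀ n ≤ k, f n ≤ k + 3)
    (hinj : ∀ m n, m ≤ k → n ≤ k → f m = f n → m = n)
    (harc : ∀ n < k, IndexArc (k + 2) (f n) (f (n + 1)) ∨ E (f n) (f (n + 1))) :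
    DAdj A (extendPath (k + 2) P b b (f 0)) (extendPath (k + 2) P b b (f k)) := by
  refine H.quasi (fun n => extendPath (k + 2) P b b (f n)) ⟨?_, ?_⟩
  · intro m n hm hn h
    refine hinj m n hm hn ?_
    have hb' : ∀ i ≤ k + 2, P i ≠ b := fun i hi e => hb ⟨i, hi, e⟩
    have h1 := hf m hm
    have h2 := hf n hn
    have := H.inj
    simp only [extendPath] at h
    grind
  · intro n hn
    rcases harc n hn with h | h
    · have := H.arc _ _ h
      simpa only [extendPath_of_le h.1, extendPath_of_le h.2.1] using this
    · exact hE _ _ h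

theorem dAdj_out_straight (H : BipartitePath A k P) (hb : b ∉ VertsUpTo (k + 2) P) {j e : ℕ}
    (hj : A b (P j)) (he : e + 1 = j + k) (heN : e ≤ k + 2) : DAdj A b (P e) := by
  have h5 := H.five_le
  have := H.dAdj_of_indexPath hb (fun i i' => i = k + 3 ∧ i' = j)
    (by
      rintro _ _ ⟨rfl, rfl⟩
      rwa [extendPath_fst, extendPath_of_le (by omega)])
    (fun n => if n = 0 then k + 3 else j + n - 1)
    (by grind) (by grind) (by unfold IndexArc; grind)
  rwa [if_pos rfl, if_neg (by omega), extendPath_fst, extendPath_of_le (by omega),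
    show j + k - 1 = e by omega] at this

theorem dAdj_in_straight (H : BipartitePath A k P) (hb : b ∉ VertsUpTo (k + 2) P) {j e : ℕ}
    (hj : A (P e) b) (he : e + 1 = j + k) (heN : e ≤ k + 2) : DAdj A (P j) b := by
  have h5 := H.five_le
  have := H.dAdj_of_indexPath hb (fun i i' => i = e ∧ i' = k + 3)
    (by
      rintro _ _ ⟨rfl, rfl⟩
      rwa [extendPath_fst, extendPath_of_le (by omega)])
    (fun n => if n = k then k + 3 else j + n)
    (by grind) (by grind) (by unfold IndexArc; grind)
  rwa [if_pos rfl, if_neg (by omega), extendPath_fst, extendPath_of_le (by omega),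
    show j + 0 = j by omega] at this

/-- Follow `b → P j → ⋯ → P t → P s → ⋯ → P e`. -/
theorem dAdj_out_jump (H : BipartitePath A k P) (hb : b ∉ VertsUpTo (k + 2) P) {j e : ℕ}
    (hj : A b (P j)) (t s : ℕ) (hjt : j ≤ t) (ht : t ≤ k + 2) (hse : s ≤ e) (hej : e < j)
    (hpar : (t + s) % 2 = 1) (hlen : t + e + 2 = k + j + s) :
    DAdj A b (P e) := by
  have h5 := H.five_le
  have := H.dAdj_of_indexPath hb (fun i i' => i = k + 3 ∧ i' = j)
    (by
      rintro _ _ ⟨rfl, rfl⟩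
      rwa [extendPath_fst, extendPath_of_le (by omega)])
    (fun n => if n = 0 then k + 3 else if n ≤ t - j + 1 then j + n - 1 else s + n - (t - j + 2))
    (by grind) (by grind) (by unfold IndexArc; grind)
  rwa [if_pos rfl, if_neg (by omega), if_neg (by omega), extendPath_fst,
    show s + k - (t - j + 2) = e by omega, extendPath_of_le (by omega)] at this

/-- Follow `P j → ⋯ → P t → P s → ⋯ → P e → b`. -/
theorem dAdj_in_jump (H : BipartitePath A k P) (hb : b ∉ VertsUpTo (k + 2) P) {j e : ℕ}
    (he : A (P e) b) (t s : ℕ) (hjt : j ≤ t) (ht : t ≤ k + 2) (hse : s ≤ e) (hej : e < j)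
    (hpar : (t + s) % 2 = 1) (hlen : t + e + 2 = k + j + s) :
    DAdj A (P j) b := by
  have h5 := H.five_le
  have := H.dAdj_of_indexPath hb (fun i i' => i = e ∧ i' = k + 3)
    (by
      rintro _ _ ⟨rfl, rfl⟩
      rwa [extendPath_fst, extendPath_of_le (by omega)])
    (fun n => if n = k then k + 3 else if n ≤ t - j then j + n else s + n - (t - j + 1))
    (by grind) (by grind) (by unfold IndexArc; grind)
  rwa [if_pos rfl, if_neg (by omega), if_pos (by omega), extendPath_fst,
    show j + 0 = j by omega, extendPath_of_le (by omega)] at this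

/-- Follow `b → P j → ⋯ → P e → c`. -/
theorem dAdj_between (H : BipartitePath A k P) (hb : b ∉ VertsUpTo (k + 2) P)
    (hc : c ∉ VertsUpTo (k + 2) P) (hbc : b ≠ c) {j e : ℕ} (hj : A b (P j)) (he : A (P e) c)
    (hlen : e + 2 = j + k) (heN : e ≤ k + 2) : DAdj A b c := by
  have h5 := H.five_le
  have := H.dAdj_of_indexPath_two hb hc hbc
    (fun i i' => (i = k + 3 ∧ i' = j) ∨ (i = e ∧ i' = k + 4))
    (by
      rintro _ _ (⟨rfl, rfl⟩ | ⟨rfl, rfl⟩)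
      · rwa [extendPath_fst, extendPath_of_le (by omega)]
      · rwa [extendPath_snd, extendPath_of_le (by omega)])
    (fun n => if n = 0 then k + 3 else if n = k then k + 4 else j + n - 1)
    (by grind) (by grind) (by unfold IndexArc; grind)
  rwa [if_pos rfl, if_neg (by omega), if_pos rfl, extendPath_fst, extendPath_snd] at this

/-- Follow `b → c → P j → ⋯ → P e`. -/
theorem dAdj_chain (H : BipartitePath A k P) (hb : b ∉ VertsUpTo (k + 2) P)
    (hc : c ∉ VertsUpTo (k + 2) P) (hbc : b ≠ c) {j e : ℕ} (hA : A b c) (hj : A c (P j))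
    (hlen : e + 2 = j + k) (heN : e ≤ k + 2) : DAdj A b (P e) := by
  have h5 := H.five_le
  have := H.dAdj_of_indexPath_two hb hc hbc
    (fun i i' => (i = k + 3 ∧ i' = k + 4) ∨ (i = k + 4 ∧ i' = j))
    (by
      rintro _ _ (⟨rfl, rfl⟩ | ⟨rfl, rfl⟩)
      · rwa [extendPath_fst, extendPath_snd]
      · rwa [extendPath_snd, extendPath_of_le (by omega)])
    (fun n => if n = 0 then k + 3 else if n = 1 then k + 4 else j + n - 2)
    (by grind) (by grind) (by unfold IndexArc; grind)
  rwa [if_pos rfl, if_neg (by omega), if_neg (by omega), extendPath_fst,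
    show j + k - 2 = e by omega, extendPath_of_le (by omega)] at this

/-- Follow `P i → b → P j → ⋯ → P e`. -/
theorem not_through_straight (H : BipartitePath A k P) (hb : b ∉ VertsUpTo (k + 2) P)
    {i j : ℕ} (hi : A (P i) b) (hj : A b (P j)) (e : ℕ) (hlen : e + 2 = j + k)
    (heN : e < i) (hiN : i ≤ k + 2) (hpar : (i + e) % 2 = 0) : False := by
  have h5 := H.five_le
  have := H.dAdj_of_indexPath hb
    (fun a a' => (a = i ∧ a' = k + 3) ∨ (a = k + 3 ∧ a' = j))
    (by
      rintro _ _ (⟨rfl, rfl⟩ | ⟨rfl, rfl⟩)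
      · rwa [extendPath_fst, extendPath_of_le (by omega)]
      · rwa [extendPath_fst, extendPath_of_le (by omega)])
    (fun n => if n = 0 then i else if n = 1 then k + 3 else j + n - 2)
    (by grind) (by grind) (by unfold IndexArc; grind)
  rw [if_pos rfl, if_neg (by omega), if_neg (by omega), extendPath_of_le (by omega),
    show j + k - 2 = e by omega, extendPath_of_le (by omega)] at this
  exact H.nonadj i e (by omega) (by omega) hpar this

/-- Follow `P i → b → P j → ⋯ → P t → P s`. -/
theorem not_through_jump (H : BipartitePath A k P) (hb : b ∉ VertsUpTo (k + 2) P)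
    {i j : ℕ} (hi : A (P i) b) (hj : A b (P j)) (t s : ℕ) (hlen : t + 3 = j + k)
    (hti : t < i) (hiN : i ≤ k + 2) (hsj : s < j) (hst : s + 3 ≤ t) (hts : (t + s) % 2 = 1)
    (hpar : (i + s) % 2 = 0) : False := by
  have h5 := H.five_le
  have := H.dAdj_of_indexPath hb
    (fun a a' => (a = i ∧ a' = k + 3) ∨ (a = k + 3 ∧ a' = j))
    (by
      rintro _ _ (⟨rfl, rfl⟩ | ⟨rfl, rfl⟩)
      · rwa [extendPath_fst, extendPath_of_le (by omega)]
      · rwa [extendPath_fst, extendPath_of_le (by omega)])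
    (fun n => if n = 0 then i else if n = 1 then k + 3 else if n = k then s else j + n - 2)
    (by grind) (by grind) (by unfold IndexArc; grind)
  rw [if_pos rfl, if_neg (by omega), if_neg (by omega), if_pos rfl,
    extendPath_of_le (by omega), extendPath_of_le (by omega)] at this
  exact H.nonadj i s (by omega) (by omega) hpar this

/-- Follow `P (k + 1) → P (k + 2) → P (k - 1) → b → P 3 → ⋯ → P (k - 2) → P 0`. -/
theorem not_through_three (H : BipartitePath A k P) (hb : b ∉ VertsUpTo (k + 2) P)
    (hi : A (P (k - 1)) b) (hj : A b (P 3)) : False := by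
  have h5 := H.five_le
  have h2 := H.odd
  have := H.dAdj_of_indexPath hb
    (fun a a' => (a = k - 1 ∧ a' = k + 3) ∨ (a = k + 3 ∧ a' = 3))
    (by
      rintro _ _ (⟨rfl, rfl⟩ | ⟨rfl, rfl⟩)
      · rwa [extendPath_fst, extendPath_of_le (by omega)]
      · rwa [extendPath_fst, extendPath_of_le (by omega)])
    (fun n => if n = 0 then k + 1 else if n = 1 then k + 2 else if n = 2 then k - 1 else
      if n = 3 then k + 3 else if n = k then 0 else n - 1)
    (by grind) (by grind (splits := 20)) (by unfold IndexArc; grind)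
  rw [if_pos rfl, if_neg (by omega), if_neg (by omega), if_neg (by omega), if_neg (by omega),
    if_pos rfl, extendPath_of_le (by omega), extendPath_of_le (by omega)] at this
  exact H.nonadj (k + 1) 0 (by omega) (by omega) (by omega) this

theorem descend (H : BipartitePath A k P) (hb : b ∉ VertsUpTo (k + 2) P) {j : ℕ}
    (hjN : j ≤ k + 2) (hj : A b (P j)) : A b (P (j % 4)) := by
  induction j using Nat.strong_induction_on with
  | _ j ih =>
    have h2 := H.odd
    by_cases h4 : j < 4
    · rwa [Nat.mod_eq_of_lt h4]
    · have hadj : DAdj A b (P (j - 4)) := H.dAdj_out_jump hb hj (k + 2) 0 (by omega) (by omega)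
        (by omega) (by omega) (by omega) (by omega)
      rw [show j % 4 = (j - 4) % 4 by omega]
      refine ih (j - 4) (by omega) (by omega) (hadj.resolve_right fun h => ?_)
      have := H.short b hb _ _ (by omega) hjN h hj
      omega

theorem ascend (H : BipartitePath A k P) (hb : b ∉ VertsUpTo (k + 2) P) {i : ℕ}
    (hi : A (P i) b) (j : ℕ) (hij : i ≤ j) (hmod : j % 4 = i % 4) (hjN : j ≤ k + 2) :
    A (P j) b := by
  induction j using Nat.strong_induction_on with
  | _ j ih =>
    have h2 := H.odd
    rcases hij.eq_or_lt with rfl | hlt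
    · exact hi
    · have hj := ih (j - 4) (by omega) (by omega) (by omega) (by omega)
      have hadj : DAdj A (P j) b := H.dAdj_in_jump hb hj (k + 2) 0 (by omega) (by omega)
        (by omega) (by omega) (by omega) (by omega)
      refine hadj.resolve_right fun h => ?_
      have := H.short b hb _ _ (by omega) hjN hj h
      omega

theorem out_low (H : BipartitePath A k P) (hb : b ∉ VertsUpTo (k + 2) P) {j : ℕ}
    (hjN : j ≤ k + 2) (hj : A b (P j)) : A b (P (j % 2)) ∨ A b (P (j % 2 + 2)) := by
  have h := H.descend hb hjN hj
  rcases (by omega : j % 4 = j % 2 ∨ j % 4 = j % 2 + 2) with e | e <;> rw [e] at h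
  · exact .inl h
  · exact .inr h

theorem in_high (H : BipartitePath A k P) (hb : b ∉ VertsUpTo (k + 2) P) {i : ℕ}
    (hiN : i ≤ k + 2) (hi : A (P i) b) :
    A (P (k - 1 + i % 2)) b ∨ A (P (k + 1 + i % 2)) b := by
  have h2 := H.odd
  have h5 := H.five_le
  by_cases hm : i ≤ k - 1 + i % 2 ∧ (k - 1 + i % 2) % 4 = i % 4
  · exact .inl (H.ascend hb hi _ hm.1 hm.2 (by omega))
  · by_cases hm' : (k + 1 + i % 2) % 4 = i % 4
    · exact .inr (H.ascend hb hi _ (by omega) hm' (by omega))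
    · omega

theorem parity_eq (H : BipartitePath A k P) (hb : b ∉ VertsUpTo (k + 2) P) {i j : ℕ}
    (hiN : i ≤ k + 2) (hjN : j ≤ k + 2) (hi : A (P i) b) (hj : A b (P j)) :
    i % 2 = j % 2 := by
  have h2 := H.odd
  have h5 := H.five_le
  have hlow := H.out_low hb hjN hj
  have hhigh := H.in_high hb hiN hi
  by_contra hne
  rcases (by omega : (i % 2 = 1 ∧ j % 2 = 0) ∨ (i % 2 = 0 ∧ j % 2 = 1)) with ⟨ei, ej⟩ | ⟨ei, ej⟩
  · rw [ej] at hlow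
    rw [ei] at hhigh
    rcases hlow with hl | hl <;> rcases hhigh with hh | hh
    · exact H.not_through_straight hb hh hl (k - 2) (by omega) (by omega) (by omega) (by omega)
    · exact H.not_through_straight hb hh hl (k - 2) (by omega) (by omega) (by omega) (by omega)
    · exact H.not_through_jump hb hh hl (k - 1) 1 (by omega) (by omega) (by omega) (by omega)
        (by omega) (by omega) (by omega)
    · exact H.not_through_straight hb hh hl k (by omega) (by omega) (by omega) (by omega)
  · rw [ej] at hlow
    rw [ei] at hhigh
    rcases hlow with hl | hl <;> rcases hhigh with hh | hh
    · exact H.not_through_jump hb hh hl (k - 2) 0 (by omega) (by omega) (by omega) (by omega)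
        (by omega) (by omega) (by omega)
    · exact H.not_through_straight hb hh hl (k - 1) (by omega) (by omega) (by omega) (by omega)
    · exact H.not_through_three hb hh hl
    · exact H.not_through_jump hb hh hl k 0 (by omega) (by omega) (by omega) (by omega)
        (by omega) (by omega) (by omega)

/-- Two outer vertices attached to the same parity class of `P` are not joined by an arc. -/
theorem not_arc_of_same_parity (H : BipartitePath A k P) (hirr : ∀ x, ¬ A x x)
    (hb : b ∉ VertsUpTo (k + 2) P) (hc : c ∉ VertsUpTo (k + 2) P) {i j l : ℕ}
    (hi : i ≤ k + 2) (hj : j ≤ k + 2) (hl : l ≤ k + 2) (hib : A (P i) b) (hbj : A b (P j))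
    (hcl : A c (P l)) (hpar : l % 2 = j % 2) : ¬ A b c := by
  intro hA
  have h2 := H.odd
  have h5 := H.five_le
  have hbc : b ≠ c := by
    rintro rfl
    exact hirr _ hA
  have key : ∀ m, m ≤ 3 → m % 2 = j % 2 → ¬ A c (P m) := by
    intro m hm hmj hcm
    rcases H.dAdj_chain (e := m + k - 2) hb hc hbc hA hcm (by omega) (by omega) with h | h
    · have := H.parity_eq hb hi (by omega) hib h
      have := H.parity_eq hb hi hj hib hbj
      omega
    · have := H.parity_eq hb (by omega) hj h hbj
      omega
  rcases H.out_low hc hl hcl with h | h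
  · exact key _ (by omega) (by omega) h
  · exact key _ (by omega) (by omega) h

/-- Outer vertices attached to the even and the odd class of `P` respectively are adjacent. -/
theorem dAdj_of_even_odd (H : BipartitePath A k P)
    (hb : b ∉ VertsUpTo (k + 2) P) (hc : c ∉ VertsUpTo (k + 2) P) (hbc : b ≠ c)
    (hbo : A b (P 0) ∨ A b (P 2)) (hbi : A (P (k - 1)) b ∨ A (P (k + 1)) b)
    (hco : A c (P 1) ∨ A c (P 3)) (hci : A (P k) c ∨ A (P (k + 2)) c) : DAdj A b c := by
  have h2 := H.odd
  have h5 := H.five_le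
  by_contra hn
  have hn' : ¬ DAdj A c b := fun h => hn h.symm
  have n1 : A c (P 1) → A (P (k - 1)) b → False := fun h h' =>
    hn' (H.dAdj_between hc hb hbc.symm h h' (by omega) (by omega))
  have n2 : A c (P 3) → A (P (k + 1)) b → False := fun h h' =>
    hn' (H.dAdj_between hc hb hbc.symm h h' (by omega) (by omega))
  have n3 : A b (P 2) → A (P k) c → False := fun h h' =>
    hn (H.dAdj_between hb hc hbc h h' (by omega) (by omega))
  have n4 : A b (P 0) → A (P (k - 2)) c → False := fun h h' =>
    hn (H.dAdj_between hb hc hbc h h' (by omega) (by omega))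
  have hk : k % 4 = 1 ∨ k % 4 = 3 := by omega
  by_cases hc1 : A c (P 1)
  · have hbk : ¬ A (P (k - 1)) b := n1 hc1
    have hbk1 : A (P (k + 1)) b := hbi.resolve_left hbk
    have hc3 : ¬ A c (P 3) := fun h => n2 h hbk1
    have three_of_top : A (P (k + 2)) c → A (P 3) c := fun h =>
      (H.dAdj_in_straight hc h (j := 3) (by omega) (by omega)).resolve_right hc3
    have of_two : A b (P 2) → A (P 3) c ∧ k = 5 := by
      intro hb2
      have hck : ¬ A (P k) c := n3 hb2
      have h3 := three_of_top (hci.resolve_left hck)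
      have hck' : A c (P k) :=
        (H.dAdj_out_straight hc hc1 (e := k) (by omega) (by omega)).resolve_right hck
      have := H.short c hc _ _ (by omega) (by omega) h3 hck'
      exact ⟨h3, by omega⟩
    by_cases hb0 : A b (P 0)
    · have hbk' : A b (P (k - 1)) :=
        (H.dAdj_out_straight hb hb0 (e := k - 1) (by omega) (by omega)).resolve_right hbk
      have hd := H.descend hb (by omega) hbk'
      rcases hk with hk | hk
      · have htop : A (P (k + 2)) c := by
          by_contra hno
          have hadj : DAdj A (P (k + 2)) c := H.dAdj_in_jump hc (hci.resolve_right hno) (k + 2) 2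
            (by omega) (by omega) (by omega) (by omega) (by omega) (by omega)
          have := H.descend hc (by omega) (hadj.resolve_left hno)
          rw [show (k + 2) % 4 = 3 by omega] at this
          exact hc3 this
        exact n4 hb0 (H.ascend hc (three_of_top htop) (k - 2) (by omega) (by omega) (by omega))
      · rw [show (k - 1) % 4 = 2 by omega] at hd
        have := (of_two hd).2
        omega
    · have hb2 := hbo.resolve_left hb0
      have h0 : A (P 0) b := (H.dAdj_out_jump hb hb2 (e := 0) k 0 (by omega) (by omega) (by omega)
        (by omega) (by omega) (by omega)).resolve_left hb0
      have := (of_two hb2).2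
      exact hbk (H.ascend hb h0 (k - 1) (by omega) (by omega) (by omega))
  · have hc3 := hco.resolve_left hc1
    have hbk1 : ¬ A (P (k + 1)) b := n2 hc3
    have hbk := hbi.resolve_right hbk1
    have h1 : A (P 1) c := (H.dAdj_out_jump hc hc3 (e := 1) (k + 1) 1 (by omega) (by omega)
      (by omega) (by omega) (by omega) (by omega)).resolve_left hc1
    have hbk' : A b (P (k + 1)) := (H.dAdj_in_jump hb hbk (j := k + 1) (k + 1) 1 (by omega)
      (by omega) (by omega) (by omega) (by omega) (by omega)).resolve_left hbk1
    have hd := H.descend hb (by omega) hbk'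
    rcases hk with hk | hk
    · rw [show (k + 1) % 4 = 2 by omega] at hd
      exact n3 hd (H.ascend hc h1 k (by omega) (by omega) (by omega))
    · rw [show (k + 1) % 4 = 0 by omega] at hd
      exact n4 hd (H.ascend hc h1 (k - 2) (by omega) (by omega) (by omega))

theorem semicompleteBipartiteOn_bSet (H : BipartitePath A k P) (hirr : ∀ x, ¬ A x x) :
    SemicompleteBipartiteOn A (BSet A (VertsUpTo (k + 2) P)) := by
  have hB : ∀ b ∈ BSet A (VertsUpTo (k + 2) P), b ∉ VertsUpTo (k + 2) P ∧
      (∃ i ≤ k + 2, A (P i) b) ∧ ∃ j ≤ k + 2, A b (P j) := by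
    rintro b ⟨hb, hI, hW⟩
    refine ⟨hb, ?_, ?_⟩
    · by_contra! h
      exact hI ⟨hb, by rintro _ ⟨i, hi, rfl⟩; exact h i hi⟩
    · by_contra! h
      exact hW ⟨hb, by rintro _ ⟨i, hi, rfl⟩; exact h i hi⟩
  let C : ℕ → Set V := fun r =>
    {b | b ∈ BSet A (VertsUpTo (k + 2) P) ∧ ∃ j ≤ k + 2, j % 2 = r ∧ A b (P j)}
  have hC : ∀ r, ∀ x ∈ C r, ∀ y ∈ C r, ¬ A x y := by
    rintro r x ⟨hx, j, hj, hjr, hxj⟩ y ⟨hy, l, hl, hlr, hyl⟩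
    obtain ⟨hxP, ⟨i, hi, hix⟩, -⟩ := hB x hx
    exact H.not_arc_of_same_parity hirr hxP (hB y hy).1 hi hj hl hix hxj hyl (by omega)
  have hdisj : ∀ b, b ∈ C 0 → b ∈ C 1 → False := by
    rintro b ⟨hb, j, hj, hj0, hbj⟩ ⟨-, l, hl, hl1, hbl⟩
    obtain ⟨hbP, ⟨i, hi, hib⟩, -⟩ := hB b hb
    have := H.parity_eq hbP hi hj hib hbj
    have := H.parity_eq hbP hi hl hib hbl
    omega
  refine ⟨C 0, C 1, ?_, ?_, ?_, ?_, ?_⟩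
  · ext b
    constructor
    · rintro (h | h) <;> exact h.1
    · intro h
      obtain ⟨-, -, j, hj, hbj⟩ := hB b h
      rcases Nat.mod_two_eq_zero_or_one j with e | e
      · exact .inl ⟨h, j, hj, e, hbj⟩
      · exact .inr ⟨h, j, hj, e, hbj⟩
  · ext b
    exact ⟨fun h => hdisj b h.1 h.2, fun h => h.elim⟩
  · exact fun x hx y hy h => h.elim (hC 0 x hx y hy) (hC 0 y hy x hx)
  · exact fun x hx y hy h => h.elim (hC 1 x hx y hy) (hC 1 y hy x hx)
  · intro x hx y hy
    have hxy : x ≠ y := by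
      rintro rfl
      exact hdisj _ hx hy
    obtain ⟨hxB, j, hj, hj0, hxj⟩ := hx
    obtain ⟨hyB, l, hl, hl1, hyl⟩ := hy
    obtain ⟨hxP, ⟨i, hi, hix⟩, -⟩ := hB x hxB
    obtain ⟨hyP, ⟨m, hm, hmy⟩, -⟩ := hB y hyB
    have hi0 := (H.parity_eq hxP hi hj hix hxj).trans hj0
    have hm1 := (H.parity_eq hyP hm hl hmy hyl).trans hl1
    have h5 := H.five_le
    have hxo := H.out_low hxP hj hxj
    have hxi := H.in_high hxP hi hix
    have hyo := H.out_low hyP hl hyl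
    have hyi := H.in_high hyP hm hmy
    rw [hj0] at hxo
    rw [hi0] at hxi
    rw [hl1] at hyo
    rw [hm1, show k - 1 + 1 = k by omega] at hyi
    exact H.dAdj_of_even_odd hxP hyP hxy hxo hxi hyo hyi

end BipartitePath

/-- A shortest path has no shortcut arc. -/
theorem IsDipathOn.not_arc_of_shortest {A : V → V → Prop} {N : ℕ} {P : ℕ → V}
    (hP : IsDipathOn A N P) (hmin : ∀ m < N, ¬ HasDipath A m (P 0) (P N)) {i j : ℕ}
    (hij : i + 1 < j) (hj : j ≤ N) : ¬ A (P i) (P j) := by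
  intro h
  refine hmin (i + 1 + (N - j)) (by omega)
    ⟨fun n => P (if n ≤ i then n else j + n - (i + 1)), ⟨?_, ?_⟩, by simp, ?_⟩
  · intro a b ha hb hab
    have := hP.1 _ _ (by grind) (by grind) hab
    grind
  · intro n hn
    rcases lt_trichotomy n i with hlt | rfl | hgt
    · have := hP.2 n (by omega)
      simpa [show n ≤ i by omega, show n + 1 ≤ i by omega] using this
    · simpa using h
    · have := hP.2 (j + n - (i + 1)) (by omega)
      simpa [show ¬ n ≤ i by omega, show ¬ n + 1 ≤ i by omega,
        show j + (n + 1) - (i + 1) = j + n - (i + 1) + 1 by omega] using this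
  · simp only
    congr 1
    grind

/-- A shortest path cannot be shortened through an outer vertex. -/
theorem IsDipathOn.le_of_shortest {A : V → V → Prop} {N : ℕ} {P : ℕ → V}
    (hP : IsDipathOn A N P) (hmin : ∀ m < N, ¬ HasDipath A m (P 0) (P N)) {b : V}
    (hb : b ∉ VertsUpTo N P) {i j : ℕ} (hi : i ≤ N) (hj : j ≤ N)
    (hib : A (P i) b) (hbj : A b (P j)) : j ≤ i + 2 := by
  by_contra! hij
  have hb' : ∀ a ≤ N, P a ≠ b := fun a ha e => hb ⟨a, ha, e⟩
  refine hmin (i + 2 + (N - j)) (by omega)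
    ⟨fun n => if n = i + 1 then b else P (if n ≤ i then n else j + n - (i + 2)),
      ⟨?_, ?_⟩, by simp, ?_⟩
  · intro a c ha hc hac
    have := hP.1
    grind
  · intro n hn
    rcases (by omega : n < i ∨ n = i ∨ n = i + 1 ∨ i + 1 < n) with hlt | rfl | rfl | hgt
    · have := hP.2 n (by omega)
      simpa [show n ≠ i + 1 by omega, show n ≠ i by omega, show n ≤ i by omega,
        show n + 1 ≤ i by omega] using this
    · simpa using hib
    · simpa using hbj
    · have := hP.2 (j + n - (i + 2)) (by omega)
      simpa [show n ≠ i + 1 by omega, show n ≠ i by omega, show ¬ n ≤ i by omega,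
        show ¬ n + 1 ≤ i by omega,
        show j + (n + 1) - (i + 2) = j + n - (i + 2) + 1 by omega] using this
  · simp only
    rw [if_neg (by omega)]
    congr 1
    grind

/-- A semicomplete bipartite digraph on a path has the parity classes as its parts. -/
theorem IsDipathOn.dAdj_iff_of_bipartite {A : V → V → Prop} {N : ℕ} {P : ℕ → V}
    (hP : IsDipathOn A N P) (hbip : SemicompleteBipartiteOn A (VertsUpTo N P)) {i j : ℕ}
    (hi : i ≤ N) (hj : j ≤ N) : DAdj A (P i) (P j) ↔ (i + j) % 2 = 1 := by
  obtain ⟨X, Y, hXY, hdis, hX, hY, hadj⟩ := hbip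
  have hmem : ∀ n ≤ N, P n ∈ X ∨ P n ∈ Y := fun n hn => by
    have : P n ∈ X ∪ Y := hXY ▸ ⟨n, hn, rfl⟩
    exact this
  have hnot : ∀ n, P n ∈ X → P n ∉ Y := fun n hx hy => by
    have : P n ∈ X ∩ Y := ⟨hx, hy⟩
    rw [hdis] at this
    exact this
  have hpar : ∀ n ≤ N, P n ∈ X ↔ (P 0 ∈ X ↔ n % 2 = 0) := by
    intro n
    induction n with
    | zero => simp
    | succ n ih =>
      intro hn
      have ih := ih (by omega)
      have harc : DAdj A (P n) (P (n + 1)) := .inl (hP.2 n (by omega))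
      have h1 := hmem n (by omega)
      have h2 := hmem (n + 1) hn
      have h3 : ¬ (P n ∈ X ∧ P (n + 1) ∈ X) := fun h => hX _ h.1 _ h.2 harc
      have h4 : ¬ (P n ∈ Y ∧ P (n + 1) ∈ Y) := fun h => hY _ h.1 _ h.2 harc
      have h5 := hnot n
      have h6 := hnot (n + 1)
      have h7 : (n + 1) % 2 = 0 ↔ ¬ n % 2 = 0 := by omega
      tauto
  have hiX := hpar i hi
  have hjX := hpar j hj
  have hmi := hmem i hi
  have hmj := hmem j hj
  have key : (i + j) % 2 = 1 ↔ ¬ (i % 2 = 0 ↔ j % 2 = 0) := by omega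
  have hiff : (i + j) % 2 = 1 ↔ ¬ (P i ∈ X ↔ P j ∈ X) := by
    rw [key, hiX, hjX]
    by_cases h0 : P 0 ∈ X <;> simp only [h0, true_iff, false_iff, not_iff_not]
  rw [hiff]
  constructor
  · intro h hij
    by_cases hx : P i ∈ X
    · exact hX _ hx _ (hij.1 hx) h
    · exact hY _ (hmi.resolve_left hx) _ (hmj.resolve_left (mt hij.2 hx)) h
  · intro h
    by_cases hx : P i ∈ X
    · exact hadj _ hx _ (hmj.resolve_left fun hy => h ⟨fun _ => hy, fun _ => hx⟩)
    · have hy : P j ∈ X := by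
        by_contra hy
        exact h ⟨fun h' => absurd h' hx, fun h' => absurd h' hy⟩
      exact (hadj _ hy _ (hmi.resolve_left hx)).symm

theorem IsDipathOn.bipartitePath {A : V → V → Prop} {k : ℕ} {P : ℕ → V}
    (hk5 : 5 ≤ k) (hkodd : Odd k) (hQT : KQuasiTransitive A k) (hP : IsDipathOn A (k + 2) P)
    (hmin : ∀ m < k + 2, ¬ HasDipath A m (P 0) (P (k + 2)))
    (hbip : SemicompleteBipartiteOn A (VertsUpTo (k + 2) P)) : BipartitePath A k P where
  five_le := hk5
  odd := Nat.odd_iff.1 hkodd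
  quasi := hQT
  inj := hP.1
  arc := by
    rintro i j ⟨hi, hj, rfl | ⟨hij, hpar⟩⟩
    · exact hP.2 i (by omega)
    · exact ((hP.dAdj_iff_of_bipartite hbip hi hj).2 hpar).resolve_right
        (hP.not_arc_of_shortest hmin (by omega) hi)
  nonadj := fun i j hi hj hpar h => by
    have := (hP.dAdj_iff_of_bipartite hbip hi hj).1 h
    omega
  short := fun _ hb _ _ hi hj => hP.le_of_shortest hmin hb hi hj

theorem stmt_14
    {V : Type*} [Fintype V] (A : V → V → Prop) (hirr : Irreflexive A)
    (k : ℕ) (hk5 : 5 ≤ k) (hkodd : Odd k)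
    (hQT : KQuasiTransitive A k) (hstrong : StrongD A)
    (u v : V) (hdist : ∀ m, m < k + 2 → ¬ HasDipath A m u v)
    (P : ℕ → V) (hP : IsDipathOn A (k + 2) P) (hPu : P 0 = u) (hPv : P (k + 2) = v)
    (hbip : SemicompleteBipartiteOn A (VertsUpTo (k + 2) P)) :
    SemicompleteBipartiteOn A (BSet A (VertsUpTo (k + 2) P)) ∨
      EmptyOn A (BSet A (VertsUpTo (k + 2) P)) := by
  subst hPu hPv
  exact .inl ((hP.bipartitePath hk5 hkodd hQT hdist hbip).semicompleteBipartiteOn_bSet hirr)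
end
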